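/- arXiv:1908.05631 — 3 statements merged into one kernel-verified Lean document; each statement's English description precedes it below -/
import Mathlib

section
/- Let ψ : ℝ → ℝ be a smooth 2π-periodic function that vanishes on a neighborhood of the set {x ∈ [−π,π] : |x| ≤ σ}. Then there is a constant C > 0, depending only on ψ, C₀, σ, and β, such that for any q > 0, any E ∈ ℝ, and any u, f as in the context (i.e. u is 2π-periodic, twice continuously differentiable, and f = −u'' + i·q·W·u − E·u), one has ∫_{−π}^{π} ψ(x)·|u'(x)|² dx ≤ C · (1 + max(0,E)·q⁻¹) · ∫_{−π}^{π} |f(x)|·|u(x)| dx. -/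
open Real MeasureTheory intervalIntegral

/-- The model damping profile `V(x) = 0` for `|x| ≤ σ`, `V(x) = (|x| - σ)^β` otherwise
(used only on the period `[-π, π]`). -/
noncomputable def dampV (σ β : ℝ) (x : ℝ) : ℝ :=
  if |x| ≤ σ then 0 else (|x| - σ) ^ β

/-- Poincare-type inequality. -/
lemma aux_poincare (N N1 D W : ℝ → ℝ) (a c : ℝ) (ha0 : 0 < a) (ha : a < π) (hc : 0 < c)
    (hN : ∀ x, HasDerivAt N (N1 x) x) (hN1c : Continuous N1) (hDc : Continuous D)
    (hN0 : ∀ x, 0 ≤ N x) (hD0 : ∀ x, 0 ≤ D x) (hW0 : ∀ x, 0 ≤ W x)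
    (hb : ∀ x, |N1 x| ≤ (1 / (4 * π)) * N x + 4 * π * D x)
    (hWi : IntervalIntegrable (fun x => W x * N x) volume (-π) π)
    (hWc : ∀ x, a ≤ |x| → |x| ≤ π → c ≤ W x) :
    ∫ x in (-π)..π, N x ≤ (4 * π / ((π - a) * c) + 16 * π ^ 2) *
      ((∫ x in (-π)..π, W x * N x) + ∫ x in (-π)..π, D x) := by
  have hpi := Real.pi_pos
  have hNc : Continuous N := continuous_iff_continuousAt.2 fun x => (hN x).continuousAt
  obtain ⟨y, hy, hmin⟩ := (isCompact_Icc (a := a) (b := π)).exists_isMinOn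
    ⟨a, le_refl _, ha.le⟩ hNc.continuousOn
  have hmin' : ∀ x ∈ Set.Icc a π, N y ≤ N x := fun x hx => hmin hx
  -- bound for N y
  have hWi' : IntervalIntegrable (fun x => W x * N x) volume a π :=
    hWi.mono_set (by
      rw [Set.uIcc_of_le ha.le, Set.uIcc_of_le (by linarith)]
      exact Set.Icc_subset_Icc_left (by linarith))
  have h1 : (π - a) * (c * N y) ≤ ∫ x in (-π)..π, W x * N x := by
    have e1 : ∫ x in a..π, (c * N y) = (π - a) * (c * N y) := by
      rw [intervalIntegral.integral_const, smul_eq_mul]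
    have e2 : ∫ x in a..π, (c * N y) ≤ ∫ x in a..π, W x * N x := by
      apply intervalIntegral.integral_mono_on ha.le (by simp) hWi'
      intro x hx
      have hx0 : |x| = x := abs_of_nonneg (by linarith [hx.1])
      exact mul_le_mul (hWc x (by rw [hx0]; exact hx.1) (by rw [hx0]; exact hx.2)) (hmin' x hx)
        (hN0 y) (hW0 x)
    have e3 : ∫ x in a..π, W x * N x ≤ ∫ x in (-π)..π, W x * N x := by
      apply intervalIntegral.integral_mono_interval (by linarith) ha.le le_rfl _ hWi
      exact Filter.Eventually.of_forall fun x => mul_nonneg (hW0 x) (hN0 x)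
    linarith
  set IW := ∫ x in (-π)..π, W x * N x
  have hB : Continuous fun x => (1 / (4 * π)) * N x + 4 * π * D x := by fun_prop
  have hBi : ∫ x in (-π)..π, ((1 / (4 * π)) * N x + 4 * π * D x) =
      (1 / (4 * π)) * (∫ x in (-π)..π, N x) + 4 * π * ∫ x in (-π)..π, D x := by
    rw [intervalIntegral.integral_add, intervalIntegral.integral_const_mul,
      intervalIntegral.integral_const_mul]
    · exact (by fun_prop : Continuous fun x => (1 / (4 * π)) * N x).intervalIntegrable _ _
    · exact (by fun_prop : Continuous fun x => 4 * π * D x).intervalIntegrable _ _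
  have hIn0 : 0 ≤ ∫ x in (-π)..π, D x :=
    intervalIntegral.integral_nonneg (by linarith) fun x _ => hD0 x
  set IN := ∫ x in (-π)..π, N x with hIN
  set ID := ∫ x in (-π)..π, D x
  have hpt : ∀ x ∈ Set.Icc (-π) π, N x ≤ N y + ((1 / (4 * π)) * IN + 4 * π * ID) := by
    intro x hx
    have e1 : ∫ t in y..x, N1 t = N x - N y :=
      intervalIntegral.integral_eq_sub_of_hasDerivAt (fun t _ => hN t)
        (hN1c.intervalIntegrable _ _)
    have e2 : |∫ t in y..x, N1 t| ≤ |∫ t in y..x, (|N1 t|)| :=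
      intervalIntegral.norm_integral_le_abs_integral_norm (f := N1) (μ := volume) (a := y) (b := x)
    have hle' : -π ≤ π := by linarith
    have hy' : y ∈ Set.Icc (-π) π := ⟨by linarith [hy.1], hy.2⟩
    have e3 : |∫ t in y..x, (|N1 t|)| ≤ |∫ t in (-π)..π, (|N1 t|)| := by
      apply intervalIntegral.abs_integral_mono_interval
      · rw [Set.uIoc, Set.uIoc]
        apply Set.Ioc_subset_Ioc
        · rw [min_eq_left hle']; exact le_min hy'.1 hx.1
        · rw [max_eq_right hle']; exact max_le hy'.2 hx.2
      · exact Filter.Eventually.of_forall fun x => abs_nonneg _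
      · exact hN1c.abs.intervalIntegrable _ _
    have e4 : ∫ t in (-π)..π, |N1 t| ≤ (1 / (4 * π)) * IN + 4 * π * ID := by
      rw [← hBi]
      exact intervalIntegral.integral_mono_on (by linarith) (hN1c.abs.intervalIntegrable _ _)
        (hB.intervalIntegrable _ _) fun t _ => hb t
    have e5 : 0 ≤ ∫ t in (-π)..π, |N1 t| :=
      intervalIntegral.integral_nonneg (by linarith) fun x _ => abs_nonneg _
    rw [abs_of_nonneg e5] at e3
    have := le_abs_self (∫ t in y..x, N1 t)
    linarith
  have h2 : IN ≤ 2 * π * (N y + ((1 / (4 * π)) * IN + 4 * π * ID)) := by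
    have : IN ≤ ∫ x in (-π)..π, (N y + ((1 / (4 * π)) * IN + 4 * π * ID)) :=
      intervalIntegral.integral_mono_on (by linarith) (hNc.intervalIntegrable _ _) (by simp) hpt
    rw [intervalIntegral.integral_const, smul_eq_mul] at this
    linarith
  have h3 : 2 * π * ((1 / (4 * π)) * IN) = IN / 2 := by field_simp; norm_num
  have h4 : IN ≤ 4 * π * N y + 16 * π ^ 2 * ID := by nlinarith
  have hac : 0 < (π - a) * c := mul_pos (by linarith) hc
  have h5 : N y ≤ IW / ((π - a) * c) := by
    rw [le_div_iff₀ hac]; linarith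
  have hIW : 0 ≤ IW := le_trans (mul_nonneg (by linarith) (mul_nonneg hc.le (hN0 y))) h1
  have h6 : 4 * π * N y ≤ 4 * π / ((π - a) * c) * IW := by
    calc 4 * π * N y ≤ 4 * π * (IW / ((π - a) * c)) := by gcongr
      _ = _ := by ring
  have h7 : 0 ≤ 4 * π / ((π - a) * c) * ID := by positivity
  have h8 : 0 ≤ 16 * π ^ 2 * IW := by positivity
  linarith

/-- Final arithmetic. -/
lemma aux_arith (K L P q E F IN ID IW IP : ℝ) (hK : 0 ≤ K) (hL : 0 ≤ L) (hP : 0 < P)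
    (hq : 0 < q) (hF : 0 ≤ F) (hIN : 0 ≤ IN) (hIW : q * IW ≤ F)
    (h1 : ID ≤ F + E * IN) (hPoin : IN ≤ P * (IW + ID)) (hIP : IP ≤ K * ID)
    (hIP2 : 0 ≤ E → IP ≤ L / 2 * IW + K * F + E * (L * IW)) :
    IP ≤ (K * (2 + 2 * P) + L * P + L + K + 1) * (1 + max 0 E * q⁻¹) * F := by
  have hW : IW ≤ q⁻¹ * F := by
    rw [inv_mul_eq_div, le_div_iff₀ hq]; linarith
  have hq' : 0 < q⁻¹ := inv_pos.2 hq
  rcases le_or_gt E 0 with hE | hE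
  · rw [max_eq_left hE]
    have : E * IN ≤ 0 := mul_nonpos_of_nonpos_of_nonneg hE hIN
    have h2 : K * ID ≤ K * F := by gcongr; linarith
    have : 0 ≤ (K * (2 + 2 * P) + L * P + L + 1) * F := by positivity
    linarith
  · rw [max_eq_right hE.le]
    set r := q⁻¹
    rcases le_or_gt (2 * P * E) 1 with hs | hs
    · have a1 : P * E * IN ≤ IN / 2 := by nlinarith
      have a2 : P * (IW + ID) ≤ P * (r * F + (F + E * IN)) := by gcongr
      have a3 : IN ≤ 2 * P * (r * F + F) := by nlinarith
      have a4 : E * IN ≤ E * (2 * P * (r * F + F)) := by gcongr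
      have a5 : 2 * P * E * F ≤ 1 * F := by gcongr
      have a6 : ID ≤ 2 * F + 2 * P * (E * r * F) := by nlinarith
      have a7 : K * ID ≤ K * (2 * F + 2 * P * (E * r * F)) := by gcongr
      have a8 : 0 ≤ (L * P + L + K + 1) * (1 + E * r) * F := by positivity
      have a9 : 0 ≤ K * (2 * (E * r * F) + 2 * P * F) := by positivity
      nlinarith
    · have b1 := hIP2 hE.le
      have b2 : L / 2 * IW ≤ L / 2 * (r * F) := by gcongr
      have b3 : E * (L * IW) ≤ E * (L * (r * F)) := by gcongr
      have b4 : L / 2 * (1 * (r * F)) ≤ L / 2 * (2 * P * E * (r * F)) := by gcongr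
      have b5 : 0 ≤ (K * (2 + 2 * P) + 1) * (1 + E * r) * F := by positivity
      have b6 : 0 ≤ (L * P + L) * F + K * (E * r * F) := by positivity
      nlinarith

/-- The main estimate, for fixed data. -/
lemma aux_main (ψ ψ1 ψ2 W : ℝ → ℝ) (a c K : ℝ) (ha0 : 0 < a) (ha : a < π) (hc : 0 < c)
    (hK : 0 ≤ K)
    (hψ : ∀ x, HasDerivAt ψ (ψ1 x) x) (hψ1 : ∀ x, HasDerivAt ψ1 (ψ2 x) x)
    (hψ2c : Continuous ψ2) (hψp : ψ (-π) = ψ π) (hψ1p : ψ1 (-π) = ψ1 π)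
    (hψ0 : ∀ x, |x| < a → ψ x = 0) (hψ20 : ∀ x, |x| < a → ψ2 x = 0)
    (hψK : ∀ x ∈ Set.Icc (-π) π, |ψ x| ≤ K) (hψ2K : ∀ x ∈ Set.Icc (-π) π, |ψ2 x| ≤ K)
    (hWm : Measurable W) (M : ℝ) (hM : ∀ x, W x ≤ M) (hW0 : ∀ x, 0 ≤ W x)
    (hWc : ∀ x, a ≤ |x| → |x| ≤ π → c ≤ W x)
    (q : ℝ) (hq : 0 < q) (E : ℝ) (u v w f : ℝ → ℂ)
    (hu : ∀ x, HasDerivAt u (v x) x) (hv : ∀ x, HasDerivAt v (w x) x) (hwc : Continuous w)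
    (hup : u (-π) = u π) (hvp : v (-π) = v π)
    (hf : ∀ x, f x = -(w x) + Complex.I * q * W x * u x - E * u x) :
    ∫ x in (-π)..π, ψ x * ‖v x‖ ^ 2 ≤
      (K * (2 + 2 * (4 * π / ((π - a) * c) + 16 * π ^ 2))
        + (K / c) * (4 * π / ((π - a) * c) + 16 * π ^ 2) + K / c + K + 1)
        * (1 + max 0 E * q⁻¹) * ∫ x in (-π)..π, ‖f x‖ * ‖u x‖ := by
  have hpi := Real.pi_pos
  have hle : -π ≤ π := by linarith
  have huc : Continuous u := continuous_iff_continuousAt.2 fun x => (hu x).continuousAt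
  have hvc : Continuous v := continuous_iff_continuousAt.2 fun x => (hv x).continuousAt
  have hψc : Continuous ψ := continuous_iff_continuousAt.2 fun x => (hψ x).continuousAt
  have hψ1c : Continuous ψ1 := continuous_iff_continuousAt.2 fun x => (hψ1 x).continuousAt
  have reD : ∀ {g : ℝ → ℂ} {g' : ℂ} {x : ℝ}, HasDerivAt g g' x →
      HasDerivAt (fun x => (g x).re) g'.re x := fun h =>
    (Complex.reCLM.hasFDerivAt.comp_hasDerivAt _ h)
  have imD : ∀ {g : ℝ → ℂ} {g' : ℂ} {x : ℝ}, HasDerivAt g g' x →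
      HasDerivAt (fun x => (g x).im) g'.im x := fun h =>
    (Complex.imCLM.hasFDerivAt.comp_hasDerivAt _ h)
  have hur := Complex.continuous_re.comp huc
  have hui := Complex.continuous_im.comp huc
  have hvr := Complex.continuous_re.comp hvc
  have hvi := Complex.continuous_im.comp hvc
  have hwr := Complex.continuous_re.comp hwc
  have hwi := Complex.continuous_im.comp hwc
  simp only [Function.comp_def] at hur hui hvr hvi hwr hwi
  have nsq : ∀ z : ℂ, ‖z‖ ^ 2 = z.re ^ 2 + z.im ^ 2 := fun z => by
    rw [← Complex.normSq_eq_norm_sq, Complex.normSq_apply]; ring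
  set N : ℝ → ℝ := fun x => (u x).re ^ 2 + (u x).im ^ 2 with hNdef
  set D : ℝ → ℝ := fun x => (v x).re ^ 2 + (v x).im ^ 2 with hDdef
  set N1 : ℝ → ℝ := fun x => 2 * ((u x).re * (v x).re + (u x).im * (v x).im) with hN1def
  set S : ℝ → ℝ := fun x => (u x).re * (w x).re + (u x).im * (w x).im with hSdef
  set T : ℝ → ℝ := fun x => (u x).re * (w x).im - (u x).im * (w x).re with hTdef
  set R : ℝ → ℝ := fun x => -S x - E * N x with hRdef
  have hNc : Continuous N := by fun_prop
  have hDc : Continuous D := by fun_prop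
  have hN1c : Continuous N1 := by fun_prop
  have hSc : Continuous S := by fun_prop
  have hTc : Continuous T := by fun_prop
  have hRc : Continuous R := by fun_prop
  have hND : ∀ x, HasDerivAt N (N1 x) x := fun x => by
    have := ((reD (hu x)).pow 2).add ((imD (hu x)).pow 2)
    exact this.congr_deriv (by simp [hN1def]; ring)
  have hN1D : ∀ x, HasDerivAt N1 (2 * (D x + S x)) x := fun x => by
    have := (((reD (hu x)).mul (reD (hv x))).add ((imD (hu x)).mul (imD (hv x)))).const_mul 2
    exact this.congr_deriv (by simp [hDdef, hSdef]; ring)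
  have hTD : ∀ x, HasDerivAt (fun x => (u x).re * (v x).im - (u x).im * (v x).re) (T x) x :=
    fun x => by
    have := ((reD (hu x)).mul (imD (hv x))).sub ((imD (hu x)).mul (reD (hv x)))
    exact this.congr_deriv (by simp [hTdef]; ring)
  have hN0 : ∀ x, 0 ≤ N x := fun x => by positivity
  have hD0 : ∀ x, 0 ≤ D x := fun x => by positivity
  -- integrability
  have hWi : IntervalIntegrable W volume (-π) π := by
    apply IntervalIntegrable.mono_fun' (g := fun _ => M) (by simp) hWm.aestronglyMeasurable
    exact Filter.Eventually.of_forall fun x => by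
      simp only [Real.norm_eq_abs, abs_of_nonneg (hW0 x)]; exact hM x
  have hWN : IntervalIntegrable (fun x => W x * N x) volume (-π) π :=
    hWi.mul_continuousOn hNc.continuousOn
  set G : ℝ → ℝ := fun x => ‖f x‖ * ‖u x‖ with hGdef
  have hfi : IntervalIntegrable f volume (-π) π := by
    have e : f = fun x => (W x : ℂ) * (Complex.I * q * u x) + (-(w x) - E * u x) := by
      funext x; rw [hf]; ring
    rw [e]
    apply IntervalIntegrable.add
    · apply IntervalIntegrable.mul_continuousOn (f := fun x => (W x : ℂ))
      · exact ⟨hWi.1.ofReal, hWi.2.ofReal⟩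
      · exact (by fun_prop : Continuous fun x => Complex.I * q * u x).continuousOn
    · exact (by fun_prop : Continuous fun x => -(w x) - E * u x).intervalIntegrable _ _
  have hGi : IntervalIntegrable G volume (-π) π :=
    hfi.norm.mul_continuousOn huc.norm.continuousOn
  have hG0 : ∀ x, 0 ≤ G x := fun x => by positivity
  -- pointwise bounds
  have hGn : ∀ x, G x = ‖f x * (starRingEnd ℂ) (u x)‖ := fun x => by simp [hGdef]
  have hRe : ∀ x, (f x * (starRingEnd ℂ) (u x)).re = R x := fun x => by
    rw [hf]; simp [hRdef, hSdef, hNdef]; ring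
  have hIm : ∀ x, (f x * (starRingEnd ℂ) (u x)).im = -T x + q * (W x * N x) := fun x => by
    rw [hf]; simp [hTdef, hNdef]; ring
  have hRG : ∀ x, |R x| ≤ G x := fun x => by
    rw [hGn, ← hRe]; exact Complex.abs_re_le_norm _
  have hIG : ∀ x, -T x + q * (W x * N x) ≤ G x := fun x => by
    rw [hGn, ← hIm]; exact Complex.im_le_norm _
  have hF : 0 ≤ ∫ x in (-π)..π, G x :=
    intervalIntegral.integral_nonneg hle fun x _ => hG0 x
  have hINn : 0 ≤ ∫ x in (-π)..π, N x :=
    intervalIntegral.integral_nonneg hle fun x _ => hN0 x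
  -- damping
  have hT0 : ∫ x in (-π)..π, T x = 0 := by
    rw [intervalIntegral.integral_eq_sub_of_hasDerivAt (fun t _ => hTD t)
      (hTc.intervalIntegrable _ _)]
    simp [hup, hvp]
  have hIW : q * (∫ x in (-π)..π, W x * N x) ≤ ∫ x in (-π)..π, G x := by
    have e : ∫ x in (-π)..π, (-T x + q * (W x * N x)) =
        q * ∫ x in (-π)..π, W x * N x := by
      rw [intervalIntegral.integral_add (f := fun x => -T x) (hTc.neg.intervalIntegrable _ _) (hWN.const_mul q),
        intervalIntegral.integral_neg, hT0, intervalIntegral.integral_const_mul]; simp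
    rw [← e]
    exact intervalIntegral.integral_mono_on hle
      ((hTc.neg.intervalIntegrable _ _).add (hWN.const_mul q)) hGi fun x _ => hIG x
  -- energy
  have hS0 : ∫ x in (-π)..π, (2 * (D x + S x)) = 0 := by
    rw [intervalIntegral.integral_eq_sub_of_hasDerivAt (fun t _ => hN1D t)
      ((by fun_prop : Continuous fun x => 2 * (D x + S x)).intervalIntegrable _ _)]
    simp [hN1def, hup, hvp]
  have hDE : ∫ x in (-π)..π, D x ≤ (∫ x in (-π)..π, G x) + E * ∫ x in (-π)..π, N x := by
    have e : ∫ x in (-π)..π, D x =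
        ∫ x in (-π)..π, ((1 / 2) * (2 * (D x + S x)) + (R x + E * N x)) := by
      congr 1; funext x; simp only [hRdef]; ring
    rw [e, intervalIntegral.integral_add
      ((by fun_prop : Continuous fun x => (1 / 2) * (2 * (D x + S x))).intervalIntegrable _ _)
      ((by fun_prop : Continuous fun x => R x + E * N x).intervalIntegrable _ _),
      intervalIntegral.integral_const_mul, hS0, intervalIntegral.integral_add
      (hRc.intervalIntegrable _ _)
      ((by fun_prop : Continuous fun x => E * N x).intervalIntegrable _ _),
      intervalIntegral.integral_const_mul]
    have : ∫ x in (-π)..π, R x ≤ ∫ x in (-π)..π, G x :=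
      intervalIntegral.integral_mono_on hle (hRc.intervalIntegrable _ _) hGi
        fun x _ => (le_abs_self _).trans (hRG x)
    linarith
  have hPo := aux_poincare N N1 D W a c ha0 ha hc hND hN1c hDc hN0 hD0 hW0 (by
    intro x
    have hs : 0 < 4 * π := by positivity
    have e1 : (1 / (4 * π)) * N x + 4 * π * D x - N1 x =
        (1 / (4 * π)) * (((u x).re - 4 * π * (v x).re) ^ 2
          + ((u x).im - 4 * π * (v x).im) ^ 2) := by
      simp only [hNdef, hDdef, hN1def]; field_simp; ring
    have e2 : (1 / (4 * π)) * N x + 4 * π * D x + N1 x =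
        (1 / (4 * π)) * (((u x).re + 4 * π * (v x).re) ^ 2
          + ((u x).im + 4 * π * (v x).im) ^ 2) := by
      simp only [hNdef, hDdef, hN1def]; field_simp; ring
    have p1 : 0 ≤ (1 / (4 * π)) * N x + 4 * π * D x - N1 x := by rw [e1]; positivity
    have p2 : 0 ≤ (1 / (4 * π)) * N x + 4 * π * D x + N1 x := by rw [e2]; positivity
    exact abs_le.2 ⟨by linarith, by linarith⟩) hWN hWc
  have hψD : ∫ x in (-π)..π, ψ x * ‖v x‖ ^ 2 = ∫ x in (-π)..π, ψ x * D x := by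
    congr 1; funext x; rw [nsq]
  rw [hψD]
  have hac : 0 < (π - a) * c := mul_pos (by linarith) hc
  -- bounds by W
  have bW : ∀ g : ℝ → ℝ, (∀ x, |x| < a → g x = 0) → (∀ x ∈ Set.Icc (-π) π, |g x| ≤ K) →
      ∀ x ∈ Set.Icc (-π) π, g x * N x ≤ K / c * (W x * N x) := by
    intro g h0 hk x hx
    rw [← mul_assoc]
    apply mul_le_mul_of_nonneg_right _ (hN0 x)
    rcases lt_or_ge (|x|) a with h | h
    · rw [h0 x h]; exact mul_nonneg (by positivity) (hW0 x)
    · have := hWc x h (abs_le.2 hx)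
      calc g x ≤ K := (le_abs_self _).trans (hk x hx)
        _ = K / c * c := by field_simp
        _ ≤ K / c * W x := by gcongr
  have bI : ∀ g : ℝ → ℝ, Continuous g → (∀ x, |x| < a → g x = 0) →
      (∀ x ∈ Set.Icc (-π) π, |g x| ≤ K) →
      ∫ x in (-π)..π, g x * N x ≤ K / c * ∫ x in (-π)..π, W x * N x := by
    intro g hg h0 hk
    rw [← intervalIntegral.integral_const_mul]
    exact intervalIntegral.integral_mono_on hle ((hg.mul hNc).intervalIntegrable _ _)
      (hWN.const_mul _) (bW g h0 hk)
  apply aux_arith K (K / c) (4 * π / ((π - a) * c) + 16 * π ^ 2) q E _ _ _ _ _ hK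
    (by positivity) (by positivity) hq hF hINn hIW hDE hPo
  · rw [← intervalIntegral.integral_const_mul]
    apply intervalIntegral.integral_mono_on hle ((hψc.mul hDc).intervalIntegrable _ _)
      ((hDc.const_mul K).intervalIntegrable _ _)
    intro x hx
    exact mul_le_mul_of_nonneg_right ((le_abs_self _).trans (hψK x hx)) (hD0 x)
  · intro hE
    have hQD : ∀ x, HasDerivAt (fun x => ψ x * N1 x - ψ1 x * N x)
        (ψ x * (2 * (D x + S x)) - ψ2 x * N x) x := fun x => by
      exact (((hψ x).mul (hN1D x)).sub ((hψ1 x).mul (hND x))).congr_deriv (by ring)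
    have hQc : Continuous fun x => ψ x * (2 * (D x + S x)) - ψ2 x * N x := by fun_prop
    have hQ0 : ∫ x in (-π)..π, (ψ x * (2 * (D x + S x)) - ψ2 x * N x) = 0 := by
      rw [intervalIntegral.integral_eq_sub_of_hasDerivAt (fun t _ => hQD t)
        (hQc.intervalIntegrable _ _)]
      simp [hN1def, hNdef, hup, hvp, hψp, hψ1p]
    have e : ∫ x in (-π)..π, ψ x * D x =
        ∫ x in (-π)..π, ((1 / 2) * (ψ x * (2 * (D x + S x)) - ψ2 x * N x)
          + ((1 / 2) * (ψ2 x * N x) + (ψ x * R x + E * (ψ x * N x)))) := by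
      congr 1; funext x; simp only [hRdef]; ring
    have i1 : Continuous fun x => (1 / 2) * (ψ x * (2 * (D x + S x)) - ψ2 x * N x) := by fun_prop
    have i2 : Continuous fun x => (1 / 2) * (ψ2 x * N x) := by fun_prop
    have i3 : Continuous fun x => ψ x * R x := by fun_prop
    have i4 : Continuous fun x => E * (ψ x * N x) := by fun_prop
    rw [e, intervalIntegral.integral_add (g := fun x => (1 / 2) * (ψ2 x * N x) +
      (ψ x * R x + E * (ψ x * N x))) (i1.intervalIntegrable _ _)
      ((i2.add (i3.add i4)).intervalIntegrable _ _),
      intervalIntegral.integral_add (g := fun x => ψ x * R x + E * (ψ x * N x))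
      (i2.intervalIntegrable _ _)
      ((i3.add i4).intervalIntegrable _ _),
      intervalIntegral.integral_add (i3.intervalIntegrable _ _) (i4.intervalIntegrable _ _),
      intervalIntegral.integral_const_mul, hQ0, intervalIntegral.integral_const_mul,
      intervalIntegral.integral_const_mul]
    have j1 := bI ψ2 hψ2c hψ20 hψ2K
    have j2 := bI ψ hψc hψ0 hψK
    have j3 : ∫ x in (-π)..π, ψ x * R x ≤ K * ∫ x in (-π)..π, G x := by
      rw [← intervalIntegral.integral_const_mul]
      apply intervalIntegral.integral_mono_on hle (i3.intervalIntegrable _ _) (hGi.const_mul K)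
      intro x hx
      calc ψ x * R x ≤ |ψ x * R x| := le_abs_self _
        _ = |ψ x| * |R x| := abs_mul _ _
        _ ≤ K * G x := mul_le_mul (hψK x hx) (hRG x) (abs_nonneg _) hK
    have j4 := mul_le_mul_of_nonneg_left j2 hE
    linarith

/-- If `ψ` is smooth, `2π`-periodic, and vanishes on a neighborhood of `[-σ, σ]`, then
there is `C > 0` (depending only on `ψ, C₀, σ, β`) such that for all `q > 0`, `E ∈ ℝ`,
and `u, f` with `f = -u'' + iqWu - Eu`, one has
`∫ ψ |u'|² ≤ C (1 + max(0,E) q⁻¹) ∫ |f| |u|`. -/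
theorem damped_wave_weighted_derivative_estimate
    (C₀ σ β : ℝ) (hC₀ : 0 < C₀) (hσ : σ ∈ Set.Ioo 0 π) (hβ : 0 ≤ β)
    (ψ : ℝ → ℝ) (hψ : ContDiff ℝ (⊤ : ℕ∞) ψ) (hψper : Function.Periodic ψ (2 * π))
    (hψ0 : ∃ ε > (0 : ℝ), ∀ x : ℝ, |x| < σ + ε → ψ x = 0) :
    ∃ C > (0 : ℝ),
      ∀ (W : ℝ → ℝ), Function.Periodic W (2 * π) → Measurable W →
        (∃ M : ℝ, ∀ x : ℝ, W x ≤ M) → (∀ x : ℝ, 0 ≤ W x) →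
        (∀ x ∈ Set.Icc (-π) π,
          dampV σ β x / C₀ ≤ W x ∧ W x ≤ C₀ * dampV σ β x) →
        ∀ q > (0 : ℝ), ∀ E : ℝ,
          ∀ (u f : ℝ → ℂ), ContDiff ℝ 2 u → Function.Periodic u (2 * π) →
            (∀ x : ℝ,
              f x = -(deriv (deriv u) x) + Complex.I * q * W x * u x - E * u x) →
            ∫ x in (-π)..π, ψ x * ‖deriv u x‖ ^ 2 ≤
              C * (1 + max 0 E * q⁻¹) * ∫ x in (-π)..π, ‖f x‖ * ‖u x‖ := by
  obtain ⟨ε, hε, hψ0⟩ := hψ0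
  obtain ⟨hσ0, hσπ⟩ := hσ
  have hpi := Real.pi_pos
  set δ := min ε ((π - σ) / 2) with hδ
  have hδ0 : 0 < δ := lt_min hε (by linarith)
  have hδε : δ ≤ ε := min_le_left _ _
  have hδπ : δ ≤ (π - σ) / 2 := min_le_right _ _
  have hψ2' : ContDiff ℝ 2 ψ := contDiff_infty.1 hψ 2
  have twoD : ∀ {F : Type} [NormedAddCommGroup F] [NormedSpace ℝ F] {g : ℝ → F},
      ContDiff ℝ 2 g → (∀ x, HasDerivAt g (deriv g x) x) ∧
        (∀ x, HasDerivAt (deriv g) (deriv (deriv g) x) x) ∧ Continuous (deriv (deriv g)) := by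
    intro F _ _ g hg
    have h1 : ContDiff ℝ 1 (deriv g) := by
      have : ContDiff ℝ (1 + 1) g := by norm_num; exact hg
      exact (contDiff_succ_iff_deriv.1 this).2.2
    exact ⟨fun x => (hg.differentiable (by norm_num) x).hasDerivAt,
      fun x => (h1.differentiable (by norm_num) x).hasDerivAt, h1.continuous_deriv le_rfl⟩
  have perD : ∀ {F : Type} [NormedAddCommGroup F] [NormedSpace ℝ F] {g : ℝ → F},
      Function.Periodic g (2 * π) → Function.Periodic (deriv g) (2 * π) := by
    intro F _ _ g hg x
    rw [← deriv_comp_add_const]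
    congr 1
    funext y
    exact hg y
  have perE : ∀ {F : Type} {g : ℝ → F}, Function.Periodic g (2 * π) → g (-π) = g π := by
    intro F g hg
    have := hg (-π)
    rw [← this]; congr 1; ring
  obtain ⟨d1, d2, d3⟩ := twoD hψ2'
  have zD : ∀ g : ℝ → ℝ, (∀ x, |x| < σ + δ → g x = 0) → ∀ x, |x| < σ + δ → deriv g x = 0 := by
    intro g hg x hx
    have : g =ᶠ[nhds x] fun _ => 0 := by
      filter_upwards [(isOpen_lt continuous_abs continuous_const).mem_nhds hx] with y hy
      exact hg y hy
    rw [this.deriv_eq]; simp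
  have hz : ∀ x, |x| < σ + δ → ψ x = 0 := fun x hx => hψ0 x (by linarith)
  obtain ⟨K1, hK1⟩ := (isCompact_Icc (a := -π) (b := π)).exists_bound_of_continuousOn
    hψ2'.continuous.continuousOn
  obtain ⟨K2, hK2⟩ := (isCompact_Icc (a := -π) (b := π)).exists_bound_of_continuousOn
    d3.continuousOn
  set K := max 0 (max K1 K2)
  have hK : 0 ≤ K := le_max_left _ _
  have hc : 0 < δ ^ β / C₀ := div_pos (Real.rpow_pos_of_pos hδ0 _) hC₀
  have ha : σ + δ < π := by linarith
  have hac : 0 < π - (σ + δ) := by linarith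
  refine ⟨(K * (2 + 2 * (4 * π / ((π - (σ + δ)) * (δ ^ β / C₀)) + 16 * π ^ 2))
        + (K / (δ ^ β / C₀)) * (4 * π / ((π - (σ + δ)) * (δ ^ β / C₀)) + 16 * π ^ 2)
        + K / (δ ^ β / C₀) + K + 1), by positivity, ?_⟩
  intro W _ hWm ⟨M, hM⟩ hW0 hWV q hq E u f hu hup hf
  obtain ⟨u1, u2, u3⟩ := twoD hu
  refine aux_main ψ (deriv ψ) (deriv (deriv ψ)) W (σ + δ) (δ ^ β / C₀) K (by linarith) ha hc hK
    d1 d2 d3 (perE hψper) (perE (perD hψper)) hz (zD _ (zD _ hz))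
    (fun x hx => (hK1 x hx).trans ((le_max_left _ _).trans (le_max_right _ _)))
    (fun x hx => (hK2 x hx).trans ((le_max_right _ _).trans (le_max_right _ _)))
    hWm M hM hW0 ?_ q hq E u (deriv u) (deriv (deriv u)) f u1 u2 u3 (perE hup)
    (perE (perD hup)) hf
  intro x hx1 hx2
  refine le_trans ?_ (hWV x (abs_le.1 hx2)).1
  have : ¬ |x| ≤ σ := by linarith
  rw [dampV, if_neg this]
  have : δ ≤ |x| - σ := by linarith
  gcongr
end

section
/- Let δ > 0 be given, and for q > 0 define μ : [−π,π] → ℝ by μ(x) = q^δ if |x| ∈ [σ, σ + q^{−δ}] and μ(x) = 1 otherwise. Then there exist constants E₀ > 0, C > 0, and q₀ > 0, depending only on C₀, σ, β, and δ, such that for all q ≥ q₀, all real E with E₀ ≤ E ≤ q², and all u, f as in the context (i.e. u is 2π-periodic, twice continuously differentiable, and f = −u'' + i·q·W·u − E·u), one has ∫_{−π}^{π} μ·|u'|² + E·∫_{−π}^{π} μ·|u|² ≤ C·( ∫_{−π}^{π} |f|² + q·∫_{−π}^{π} W·|u|·|u'| ). -/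
open Real MeasureTheory intervalIntegral

/-- The weight `μ`, equal to `q^δ` for `|x| ∈ [σ, σ + q^{-δ}]` and `1` otherwise. -/
noncomputable def muFn (σ δ q : ℝ) (x : ℝ) : ℝ :=
  if σ ≤ |x| ∧ |x| ≤ σ + q ^ (-δ) then q ^ δ else 1

set_option maxHeartbeats 2000000 in
open Complex in
theorem pt_ineq (v p r f : ℂ) (q W E s w0 m sn ν M Mx b B : ℝ)
    (hf : f = -r + I * q * W * v - E * v) (hq : 1 ≤ q) (hW : 0 ≤ W) (hs1 : 1 ≤ s) (hsE : s ^ 2 = E)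
    (hsq : s ≤ q) (hw0 : 0 < w0) (hm0 : 0 ≤ m) (hm2 : m ≤ 2) (hsn : |sn| ≤ 1)
    (hmW : 0 < m → w0 ≤ W) (hν : 1 ≤ ν) (hM : 0 ≤ M) (hMx : M ≤ Mx) (hb : |b| ≤ B) :
    ν * ‖p‖ ^ 2 + E * (ν * ‖v‖ ^ 2) ≤
      2 * (((ν - M * m ^ 2) * ((p.re ^ 2 + p.im ^ 2) + E * (v.re ^ 2 + v.im ^ 2))
          + b * (2 * (p.re * r.re + p.im * r.im) + 2 * E * (v.re * p.re + v.im * p.im)))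
        + M * (2 * (2 * m * sn * (p.re * v.re + p.im * v.im)
              + m ^ 2 * (p.re ^ 2 + p.im ^ 2 + (r.re * v.re + r.im * v.im)))
            + 16 / w0 * s * (r.im * v.re - r.re * v.im)))
      + (8 * B ^ 2 + 2 * Mx ^ 2 * (16 / w0 + 8) ^ 2 + 4 * B) * (‖f‖ ^ 2 + q * (W * ‖v‖ * ‖p‖)) := by
  have hp2 : ‖p‖ ^ 2 = p.re ^ 2 + p.im ^ 2 := by rw [Complex.sq_norm, Complex.normSq_apply]; ring
  have hv2 : ‖v‖ ^ 2 = v.re ^ 2 + v.im ^ 2 := by rw [Complex.sq_norm, Complex.normSq_apply]; ring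
  have hfr : f.re = -r.re - q * W * v.im - E * v.re := by rw [hf]; simp; ring
  have hfi : f.im = -r.im + q * W * v.re - E * v.im := by rw [hf]; simp
  have key1 : ∀ z w : ℂ, |z.re * w.re + z.im * w.im| ≤ ‖z‖ * ‖w‖ := by
    intro z w
    have := Complex.abs_re_le_norm (z * (starRingEnd ℂ) w)
    simpa using this
  have key2 : ∀ z w : ℂ, |z.im * w.re - z.re * w.im| ≤ ‖z‖ * ‖w‖ := by
    intro z w
    have := Complex.abs_im_le_norm (z * (starRingEnd ℂ) w)
    have e : (z * (starRingEnd ℂ) w).im = z.im * w.re - z.re * w.im := by simp; ring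
    rw [e] at this
    simpa using this
  have nf := norm_nonneg f
  have nv := norm_nonneg v
  have np := norm_nonneg p
  have hB : 0 ≤ B := (abs_nonneg b).trans hb
  rw [← hp2, ← hv2]
  have hs0 : 0 ≤ s := by linarith
  have hE1 : 1 ≤ E := by nlinarith
  have hEq : E ≤ q * s := by nlinarith
  -- T2
  set T2 := r.im * v.re - r.re * v.im with hT2
  have e2 : q * W * ‖v‖ ^ 2 = T2 + (f.im * v.re - f.re * v.im) := by
    rw [hv2, hT2, hfr, hfi]; ring
  have i2 : q * W * ‖v‖ ^ 2 ≤ T2 + ‖f‖ * ‖v‖ := by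
    rw [e2]; linarith [le_abs_self (f.im * v.re - f.re * v.im), key2 f v]
  -- T3
  have e3 : r.re * v.re + r.im * v.im = -(f.re * v.re + f.im * v.im) - E * ‖v‖ ^ 2 := by
    rw [hv2, hfr, hfi]; ring
  have hWv : 0 ≤ W * ‖v‖ ^ 2 := by positivity
  have hWv0 : 0 ≤ W / w0 * ‖v‖ ^ 2 := by positivity
  have hm4 : m ^ 2 ≤ 4 := by nlinarith
  have hcut : m ^ 2 * ‖v‖ ^ 2 ≤ 4 * (W / w0 * ‖v‖ ^ 2) := by
    rcases hm0.eq_or_lt with h | h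
    · rw [← h]; simp only [ne_eq, OfNat.ofNat_ne_zero, not_false_eq_true, zero_pow, zero_mul]; linarith
    · have : 1 ≤ W / w0 := by rw [le_div_iff₀ hw0]; linarith [hmW h]
      have : ‖v‖ ^ 2 ≤ W / w0 * ‖v‖ ^ 2 := le_mul_of_one_le_left (sq_nonneg _) this
      have h5 : m ^ 2 * ‖v‖ ^ 2 ≤ 4 * ‖v‖ ^ 2 := mul_le_mul_of_nonneg_right hm4 (sq_nonneg _)
      linarith
  have hcut' : -(2 * m * sn * (p.re * v.re + p.im * v.im)) ≤
      1 / 2 * m ^ 2 * ‖p‖ ^ 2 + 2 * (W / w0 * ‖v‖ ^ 2) := by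
    have h1 : -(2 * m * sn * (p.re * v.re + p.im * v.im)) ≤ 2 * m * (‖p‖ * ‖v‖) := by
      have a1 : |sn * (p.re * v.re + p.im * v.im)| ≤ 1 * (‖p‖ * ‖v‖) := by
        rw [abs_mul]; exact mul_le_mul hsn (key1 p v) (abs_nonneg _) zero_le_one
      have a2 := neg_abs_le (sn * (p.re * v.re + p.im * v.im))
      have a3 := mul_le_mul_of_nonneg_left a1 hm0
      have a4 := mul_le_mul_of_nonneg_left a2 hm0
      linarith
    rcases hm0.eq_or_lt with h | h
    · rw [← h] at h1 ⊢; simp only [mul_zero, zero_mul, neg_zero, ne_eq, OfNat.ofNat_ne_zero, not_false_eq_true, zero_pow]; linarith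
    · have : 1 ≤ W / w0 := by rw [le_div_iff₀ hw0]; linarith [hmW h]
      have : ‖v‖ ^ 2 ≤ W / w0 * ‖v‖ ^ 2 := le_mul_of_one_le_left (sq_nonneg _) this
      nlinarith [sq_nonneg (m * ‖p‖ - 2 * ‖v‖)]
  rw [e3]
  set T3 := 2 * m * sn * (p.re * v.re + p.im * v.im)
              + m ^ 2 * (‖p‖ ^ 2 + (-(f.re * v.re + f.im * v.im) - E * ‖v‖ ^ 2)) with hT3
  have i3 : m ^ 2 * (‖p‖ ^ 2 + E * ‖v‖ ^ 2) ≤ 2 * T3 + 4 * (W / w0 * ‖v‖ ^ 2)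
      + 8 * (‖f‖ * ‖v‖) + 12 * (E * (W / w0 * ‖v‖ ^ 2)) := by
    have a1 : m ^ 2 * (f.re * v.re + f.im * v.im) ≤ 4 * (‖f‖ * ‖v‖) := by
      have h1 := (le_abs_self _).trans (key1 f v)
      have h2 : m ^ 2 * (f.re * v.re + f.im * v.im) ≤ m ^ 2 * (‖f‖ * ‖v‖) :=
        mul_le_mul_of_nonneg_left h1 (sq_nonneg m)
      have h3 : m ^ 2 * (‖f‖ * ‖v‖) ≤ 4 * (‖f‖ * ‖v‖) :=
        mul_le_mul_of_nonneg_right hm4 (by positivity)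
      linarith
    have a2 : E * (m ^ 2 * ‖v‖ ^ 2) ≤ E * (4 * (W / w0 * ‖v‖ ^ 2)) :=
      mul_le_mul_of_nonneg_left hcut (by linarith)
    rw [hT3]
    linarith
  have i4 : m ^ 2 * (‖p‖ ^ 2 + E * ‖v‖ ^ 2) ≤ 2 * T3 + 16 / w0 * s * T2
      + (16 / w0 + 8) * (s * (‖f‖ * ‖v‖)) := by
    have hfv : 0 ≤ ‖f‖ * ‖v‖ := by positivity
    have a1 : 4 * (W / w0 * ‖v‖ ^ 2) ≤ 4 * (q * s * (W / w0 * ‖v‖ ^ 2)) := by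
      have : 1 ≤ q * s := by nlinarith
      have := le_mul_of_one_le_left hWv0 this
      linarith
    have a2 : 12 * (E * (W / w0 * ‖v‖ ^ 2)) ≤ 12 * (q * s * (W / w0 * ‖v‖ ^ 2)) := by
      have := mul_le_mul_of_nonneg_right hEq hWv0
      linarith
    have a3 : 16 * (q * s * (W / w0 * ‖v‖ ^ 2)) ≤ 16 / w0 * s * (T2 + ‖f‖ * ‖v‖) := by
      have : 16 * (q * s * (W / w0 * ‖v‖ ^ 2)) = 16 / w0 * s * (q * W * ‖v‖ ^ 2) := by
        field_simp
      rw [this]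
      exact mul_le_mul_of_nonneg_left i2 (by positivity)
    have a4 : 8 * (‖f‖ * ‖v‖) ≤ 8 * (s * (‖f‖ * ‖v‖)) := by
      have := le_mul_of_one_le_left hfv hs1
      linarith
    linarith
  -- T1
  have e1 : 2 * (p.re * r.re + p.im * r.im) + 2 * E * (v.re * p.re + v.im * p.im) =
      -2 * (f.re * p.re + f.im * p.im) + 2 * (q * W) * (v.re * p.im - v.im * p.re) := by
    rw [hfr, hfi]; ring
  rw [e1]
  have i1 : -(2 * (B * (‖f‖ * ‖p‖)) + 2 * (B * (q * (W * ‖v‖ * ‖p‖)))) ≤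
     b * (-2 * (f.re * p.re + f.im * p.im) + 2 * (q * W) * (v.re * p.im - v.im * p.re)) := by
    have a1 : |b * (f.re * p.re + f.im * p.im)| ≤ B * (‖f‖ * ‖p‖) := by
      rw [abs_mul]; exact mul_le_mul hb (key1 f p) (abs_nonneg _) hB
    have a2 : |b * (v.im * p.re - v.re * p.im)| ≤ B * (‖v‖ * ‖p‖) := by
      rw [abs_mul]; exact mul_le_mul hb (key2 v p) (abs_nonneg _) hB
    have a3 := le_abs_self (b * (f.re * p.re + f.im * p.im))
    have a4 : (q * W) * (b * (v.im * p.re - v.re * p.im)) ≤ (q * W) * (B * (‖v‖ * ‖p‖)) :=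
      mul_le_mul_of_nonneg_left ((le_abs_self _).trans a2) (by positivity)
    linarith
  set T1 := b * (-2 * (f.re * p.re + f.im * p.im) + 2 * (q * W) * (v.re * p.im - v.im * p.re))
  set k := 16 / w0 + 8 with hk
  have hk0 : 0 ≤ k := by positivity
  have i5 := mul_le_mul_of_nonneg_left i4 hM
  have j1 : 2 * (B * (‖f‖ * ‖p‖)) ≤ 1 / 4 * ‖p‖ ^ 2 + 4 * B ^ 2 * ‖f‖ ^ 2 := by
    nlinarith [sq_nonneg (‖p‖ / 2 - 2 * B * ‖f‖)]
  have j2 : M * (k * (s * (‖f‖ * ‖v‖))) ≤ 1 / 4 * (E * ‖v‖ ^ 2) + M ^ 2 * k ^ 2 * ‖f‖ ^ 2 := by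
    rw [← hsE]; nlinarith [sq_nonneg (s * ‖v‖ / 2 - M * k * ‖f‖)]
  have j3 : M ^ 2 * k ^ 2 * ‖f‖ ^ 2 ≤ Mx ^ 2 * k ^ 2 * ‖f‖ ^ 2 := by gcongr
  have hg : ‖p‖ ^ 2 + E * ‖v‖ ^ 2 ≤ ν * (‖p‖ ^ 2 + E * ‖v‖ ^ 2) := by
    have : 0 ≤ ‖p‖ ^ 2 + E * ‖v‖ ^ 2 := by positivity
    exact le_mul_of_one_le_left this hν
  have hev : 0 ≤ E * ‖v‖ ^ 2 := by positivity
  have j4 : 0 ≤ (8 * B ^ 2 + 2 * Mx ^ 2 * k ^ 2) * (q * (W * ‖v‖ * ‖p‖)) := by positivity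
  have j5 : 0 ≤ 4 * B * ‖f‖ ^ 2 := by positivity
  have j6 : 0 ≤ ‖p‖ ^ 2 := by positivity
  linarith

theorem hasDerivAt_max_sq (y : ℝ) : HasDerivAt (fun y : ℝ => (max 0 y) ^ 2) (2 * max 0 y) y := by
  rcases lt_trichotomy y 0 with h | h | h
  · rw [max_eq_left h.le, mul_zero]
    refine (hasDerivAt_const y (0:ℝ)).congr_of_eventuallyEq ?_
    filter_upwards [Iio_mem_nhds h] with z hz
    rw [max_eq_left (le_of_lt hz)]; simp
  · subst h
    rw [hasDerivAt_iff_isLittleO]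
    simp only [max_self, mul_zero, smul_zero, sub_zero]
    have : (fun z : ℝ => z ^ 2) =o[nhds 0] (fun z : ℝ => z) := by
      simpa using Asymptotics.isLittleO_pow_pow (𝕜 := ℝ) (m := 1) (n := 2) (by norm_num)
    refine Asymptotics.IsBigO.trans_isLittleO ?_ this
    refine Asymptotics.IsBigO.of_bound 1 (Filter.Eventually.of_forall fun z => ?_)
    simp only [ne_eq, OfNat.ofNat_ne_zero, not_false_eq_true, zero_pow, sub_zero, norm_pow, one_mul, Real.norm_eq_abs]
    rw [sq_abs, sq_abs]
    rcases le_total z 0 with h | h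
    · rw [max_eq_left h, zero_pow two_ne_zero]; positivity
    · rw [max_eq_right h]
  · rw [max_eq_right h.le]
    have := (hasDerivAt_pow 2 y)
    norm_num at this
    refine this.congr_of_eventuallyEq ?_
    filter_upwards [Ioi_mem_nhds h] with z hz
    rw [max_eq_right (le_of_lt hz)]

theorem integral_zero_of_deriv (F F' : ℝ → ℝ) (h : ∀ x, HasDerivAt F (F' x) x)
    (hc : Continuous F') (hp : F π = F (-π)) : ∫ x in (-π)..π, F' x = 0 := by
  rw [integral_eq_sub_of_hasDerivAt (fun x _ => h x) (hc.intervalIntegrable _ _), hp, sub_self]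

theorem bdd_mul_aux (g h : ℝ → ℝ) (c : ℝ) (hh : IntervalIntegrable h volume (-π) π)
    (hg : Measurable g) (hb : ∀ x, ‖g x‖ ≤ c) :
    IntervalIntegrable (fun x => g x * h x) volume (-π) π :=
  ⟨hh.1.bdd_mul hg.aestronglyMeasurable (Filter.Eventually.of_forall hb),
    hh.2.bdd_mul hg.aestronglyMeasurable (Filter.Eventually.of_forall hb)⟩

theorem mu_le (σ δ q x : ℝ) (hq : 1 ≤ q) :
    muFn σ δ q x ≤ 1 + 2 * (1 / (1 + (q ^ δ * (x - σ)) ^ 2) * q ^ δ)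
      + 2 * (1 / (1 + (q ^ δ * (x + σ)) ^ 2) * q ^ δ) := by
  have hq0 : 0 < q := by linarith
  have hK : 0 < q ^ δ := Real.rpow_pos_of_pos hq0 δ
  have hKi : q ^ δ * q ^ (-δ) = 1 := by
    rw [← Real.rpow_add hq0]; simp
  set K := q ^ δ
  have hp1 : 0 ≤ 2 * (1 / (1 + (K * (x - σ)) ^ 2) * K) := by positivity
  have hp2 : 0 ≤ 2 * (1 / (1 + (K * (x + σ)) ^ 2) * K) := by positivity
  have key : ∀ t : ℝ, t ^ 2 ≤ 1 → K ≤ 2 * (1 / (1 + t ^ 2) * K) := by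
    intro t ht
    have : 1 / 2 ≤ 1 / (1 + t ^ 2) := one_div_le_one_div_of_le (by positivity) (by linarith)
    have := mul_le_mul_of_nonneg_right this hK.le
    linarith
  unfold muFn
  split_ifs with h
  · obtain ⟨h1, h2⟩ := h
    have h3 : K * (|x| - σ) ≤ 1 := by
      rw [← hKi]; exact mul_le_mul_of_nonneg_left (by linarith) hK.le
    have h4 : 0 ≤ K * (|x| - σ) := mul_nonneg hK.le (by linarith)
    have h5 : (K * (|x| - σ)) ^ 2 ≤ 1 := pow_le_one₀ h4 h3
    rcases le_total 0 x with hx | hx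
    · rw [abs_of_nonneg hx] at h5
      have := key _ h5
      linarith
    · rw [abs_of_nonpos hx] at h5
      have := key (K * (x + σ)) (by nlinarith)
      linarith
  · linarith

theorem mu_integrable (σ δ q : ℝ) (g : ℝ → ℝ) (hg : Continuous g) :
    IntervalIntegrable (fun x => muFn σ δ q x * g x) volume (-π) π := by
  refine bdd_mul_aux _ _ (max |q ^ δ| 1) (hg.intervalIntegrable _ _) ?_ ?_
  · unfold muFn
    refine Measurable.ite ?_ measurable_const measurable_const
    exact (measurableSet_le measurable_const measurable_abs).inter
      (measurableSet_le measurable_abs measurable_const)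
  · intro x
    unfold muFn
    split_ifs <;> simp

theorem phi_deriv (c x : ℝ) : HasDerivAt (fun x : ℝ => (max 0 (c - Real.cos x)) ^ 2)
    (2 * max 0 (c - Real.cos x) * Real.sin x) x := by
  have h1 : HasDerivAt (fun x : ℝ => c - Real.cos x) (Real.sin x) x := by
    simpa using (Real.hasDerivAt_cos x).const_sub c
  exact (hasDerivAt_max_sq (c - Real.cos x)).comp x h1

/-- Lemma 2: `∫ μ |u'|² + E ∫ μ |u|² ≲ ∫ |f|² + q ∫ W |u| |u'|`. -/
theorem damped_wave_mu_estimate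
    (C₀ σ β : ℝ) (hC₀ : 0 < C₀) (hσ : σ ∈ Set.Ioo 0 π) (hβ : 0 ≤ β)
    (δ : ℝ) (hδ : 0 < δ) :
    ∃ E₀ > (0 : ℝ), ∃ C > (0 : ℝ), ∃ q₀ > (0 : ℝ),
      ∀ (W : ℝ → ℝ), Function.Periodic W (2 * π) → Measurable W →
        (∃ M : ℝ, ∀ x : ℝ, W x ≤ M) → (∀ x : ℝ, 0 ≤ W x) →
        (∀ x ∈ Set.Icc (-π) π,
          dampV σ β x / C₀ ≤ W x ∧ W x ≤ C₀ * dampV σ β x) →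
        ∀ q ≥ q₀, ∀ E : ℝ, E₀ ≤ E → E ≤ q ^ 2 →
          ∀ (u f : ℝ → ℂ), ContDiff ℝ 2 u → Function.Periodic u (2 * π) →
            (∀ x : ℝ,
              f x = -(deriv (deriv u) x) + Complex.I * q * W x * u x - E * u x) →
            (∫ x in (-π)..π, muFn σ δ q x * ‖deriv u x‖ ^ 2) +
                E * ∫ x in (-π)..π, muFn σ δ q x * ‖u x‖ ^ 2 ≤
              C * ((∫ x in (-π)..π, ‖f x‖ ^ 2) +
                q * ∫ x in (-π)..π, W x * ‖u x‖ * ‖deriv u x‖) := by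
  obtain ⟨hσ0, hσπ⟩ := hσ
  set s₀ := (σ + π) / 2 with hs₀
  set w0 := (s₀ - σ) ^ β / C₀ with hw0d
  have hw0 : 0 < w0 := div_pos (Real.rpow_pos_of_pos (by rw [hs₀]; linarith) β) hC₀
  set c := Real.cos s₀ with hc
  set m : ℝ → ℝ := fun x => max 0 (c - Real.cos x) with hm
  have hmc : Continuous m := by rw [hm]; fun_prop
  have hm0 : ∀ x, 0 ≤ m x := fun x => le_max_left _ _
  set X : ℝ → ℝ := fun x => ∫ t in (-π)..x, m t ^ 2 with hX
  have hXd : ∀ x, HasDerivAt X (m x ^ 2) x := fun x =>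
    integral_hasDerivAt_right ((hmc.pow 2).intervalIntegrable _ _)
      ((hmc.pow 2).stronglyMeasurableAtFilter _ _) (hmc.pow 2).continuousAt
  have hXmono : Monotone X := monotone_of_hasDerivAt_nonneg hXd (fun x => sq_nonneg _)
  have hX0 : X (-π) = 0 := by simp [hX]
  have hXpos : 0 < X π := by
    refine intervalIntegral.integral_pos (by linarith [Real.pi_pos]) (hmc.pow 2).continuousOn
      (fun x _ => sq_nonneg _) ⟨π, ⟨by linarith [Real.pi_pos], le_rfl⟩, ?_⟩
    have h1 : Real.cos π < Real.cos s₀ :=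
      Real.cos_lt_cos_of_nonneg_of_le_pi (by rw [hs₀]; linarith) le_rfl (by rw [hs₀]; linarith)
    have : 0 < m π := lt_max_of_lt_right (by rw [hc]; linarith)
    positivity
  have hBpos := Real.pi_pos
  refine ⟨1, one_pos, 8 * (6 * π) ^ 2 + 2 * (6 * π / X π) ^ 2 * (16 / w0 + 8) ^ 2 + 4 * (6 * π),
    by positivity, 1, one_pos, ?_⟩
  intro W hWper hWmeas ⟨MW, hMW⟩ hW0 hWV q hq E hE1 hEq u f hu huper hf
  have hq0 : 0 < q := by linarith
  set K := q ^ δ with hK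
  have hKpos : 0 < K := Real.rpow_pos_of_pos hq0 δ
  set ν : ℝ → ℝ := fun x => 1 + 2 * (1 / (1 + (K * (x - σ)) ^ 2) * K)
      + 2 * (1 / (1 + (K * (x + σ)) ^ 2) * K) with hν
  have hν1 : ∀ x, 1 ≤ ν x := by
    intro x
    have hp1 : 0 ≤ 2 * (1 / (1 + (K * (x - σ)) ^ 2) * K) := by positivity
    have hp2 : 0 ≤ 2 * (1 / (1 + (K * (x + σ)) ^ 2) * K) := by positivity
    simp only [hν]; linarith
  have hνc : Continuous ν := by
    have h1 : ∀ x : ℝ, 1 + (K * (x - σ)) ^ 2 ≠ 0 := fun x => by positivity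
    have h2 : ∀ x : ℝ, 1 + (K * (x + σ)) ^ 2 ≠ 0 := fun x => by positivity
    rw [hν]; fun_prop (disch := assumption)
  set N : ℝ → ℝ := fun x => x + 2 * Real.arctan (K * (x - σ)) + 2 * Real.arctan (K * (x + σ)) with hN
  have hNd : ∀ x, HasDerivAt N (ν x) x := by
    intro x
    have h1 : HasDerivAt (fun x : ℝ => K * (x - σ)) K x := by
      simpa using ((hasDerivAt_id x).sub_const σ).const_mul K
    have h2 : HasDerivAt (fun x : ℝ => K * (x + σ)) K x := by
      simpa using ((hasDerivAt_id x).add_const σ).const_mul K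
    exact ((hasDerivAt_id x).add (h1.arctan.const_mul 2)).add (h2.arctan.const_mul 2)
  have hNmono : Monotone N := monotone_of_hasDerivAt_nonneg hNd (fun x => by
    have := hν1 x
    show (0:ℝ) ≤ ν x
    linarith)
  have hNb : N π - N (-π) ≤ 6 * π := by
    have a1 := Real.arctan_lt_pi_div_two (K * (π - σ))
    have a2 := Real.arctan_lt_pi_div_two (K * (π + σ))
    have a3 := Real.neg_pi_div_two_lt_arctan (K * (-π - σ))
    have a4 := Real.neg_pi_div_two_lt_arctan (K * (-π + σ))
    simp only [hN]; linarith
  have hN0 : 0 ≤ N π - N (-π) := sub_nonneg.2 (hNmono (by linarith))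
  set M := (N π - N (-π)) / X π with hM
  have hM0 : 0 ≤ M := by positivity
  have hMx : M ≤ 6 * π / X π := by rw [hM]; gcongr
  have hMX : M * X π = N π - N (-π) := by rw [hM]; field_simp
  set b : ℝ → ℝ := fun x => N x - N (-π) - M * X x with hb
  have hbd : ∀ x, HasDerivAt b (ν x - M * m x ^ 2) x := fun x =>
    ((hNd x).sub_const _).sub ((hXd x).const_mul M)
  have hbc : Continuous b := continuous_iff_continuousAt.2 fun x => (hbd x).continuousAt
  have hb1 : b (-π) = 0 := by simp [hb, hX0]
  have hb2 : b π = 0 := by simp only [hb]; rw [hMX]; ring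
  have hbB : ∀ x ∈ Set.Icc (-π) π, |b x| ≤ 6 * π := by
    intro x hx
    have a1 := hNmono hx.1
    have a2 := hNmono hx.2
    have a3 := hXmono hx.1
    have a4 := mul_le_mul_of_nonneg_left (hXmono hx.2) hM0
    rw [hX0] at a3
    have a5 := mul_nonneg hM0 a3
    rw [abs_le]; simp only [hb]
    constructor <;> linarith
  -- derivatives of u
  have hud : ∀ x, HasDerivAt u (deriv u x) x := fun x =>
    (hu.differentiable (by norm_num) x).hasDerivAt
  have hu1 : ContDiff ℝ 1 (deriv u) := by
    have : ContDiff ℝ (1 + 1) u := by norm_num; exact hu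
    exact (contDiff_succ_iff_deriv.1 this).2.2
  have hud2 : ∀ x, HasDerivAt (deriv u) (deriv (deriv u) x) x := fun x =>
    (hu1.differentiable (by norm_num) x).hasDerivAt
  have huc : Continuous u := hu.continuous
  have hpc : Continuous (deriv u) := hu1.continuous
  have hrc : Continuous (deriv (deriv u)) := hu1.continuous_deriv (by norm_num)
  have hpper : deriv u π = deriv u (-π) := by
    have h1 : (fun x => u (x + 2 * π)) = u := funext huper
    have h2 := deriv_comp_add_const u (2 * π) (-π)
    rw [h1] at h2
    rw [h2]; congr 1; ring
  have hvper : u π = u (-π) := by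
    have := huper (-π)
    rw [← this]; congr 1; ring
  set p := deriv u with hp
  set r := deriv p with hr
  have ure : ∀ x, HasDerivAt (fun x => (u x).re) (p x).re x := fun x =>
    (Complex.reCLM.hasFDerivAt.comp_hasDerivAt x (hud x))
  have uim : ∀ x, HasDerivAt (fun x => (u x).im) (p x).im x := fun x =>
    (Complex.imCLM.hasFDerivAt.comp_hasDerivAt x (hud x))
  have pre : ∀ x, HasDerivAt (fun x => (p x).re) (r x).re x := fun x =>
    (Complex.reCLM.hasFDerivAt.comp_hasDerivAt x (hud2 x))
  have pim : ∀ x, HasDerivAt (fun x => (p x).im) (r x).im x := fun x =>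
    (Complex.imCLM.hasFDerivAt.comp_hasDerivAt x (hud2 x))
  have cure : Continuous fun x => (u x).re := Complex.continuous_re.comp huc
  have cuim : Continuous fun x => (u x).im := Complex.continuous_im.comp huc
  have cpre : Continuous fun x => (p x).re := Complex.continuous_re.comp hpc
  have cpim : Continuous fun x => (p x).im := Complex.continuous_im.comp hpc
  have crre : Continuous fun x => (r x).re := Complex.continuous_re.comp hrc
  have crim : Continuous fun x => (r x).im := Complex.continuous_im.comp hrc
  set s := √E with hs
  have hsE : s ^ 2 = E := Real.sq_sqrt (by linarith)
  have hs1 : 1 ≤ s := by rw [hs]; exact Real.one_le_sqrt.2 hE1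
  have hsq : s ≤ q := Real.sqrt_le_iff.2 ⟨hq0.le, hEq⟩
  set T : ℝ → ℝ := fun x =>
    ((ν x - M * m x ^ 2) * (((p x).re ^ 2 + (p x).im ^ 2) + E * ((u x).re ^ 2 + (u x).im ^ 2))
          + b x * (2 * ((p x).re * (r x).re + (p x).im * (r x).im)
            + 2 * E * ((u x).re * (p x).re + (u x).im * (p x).im)))
        + M * (2 * (2 * m x * Real.sin x * ((p x).re * (u x).re + (p x).im * (u x).im)
              + m x ^ 2 * ((p x).re ^ 2 + (p x).im ^ 2 + ((r x).re * (u x).re + (r x).im * (u x).im)))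
            + 16 / w0 * s * ((r x).im * (u x).re - (r x).re * (u x).im)) with hT
  have hTc : Continuous T := by rw [hT]; fun_prop
  have hT0 : ∫ x in (-π)..π, T x = 0 := by
    refine integral_zero_of_deriv (fun x =>
      b x * (((p x).re ^ 2 + (p x).im ^ 2) + E * ((u x).re ^ 2 + (u x).im ^ 2))
       + M * (2 * (m x ^ 2 * ((p x).re * (u x).re + (p x).im * (u x).im))
          + 16 / w0 * s * ((p x).im * (u x).re - (p x).re * (u x).im))) T ?_ hTc ?_
    · intro x
      have d1 := (hbd x).mul ((((pre x).pow 2).add ((pim x).pow 2)).add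
        ((((ure x).pow 2).add ((uim x).pow 2)).const_mul E))
      have d3 := (phi_deriv c x).mul (((pre x).mul (ure x)).add ((pim x).mul (uim x)))
      have d2 := ((pim x).mul (ure x)).sub ((pre x).mul (uim x))
      have d := d1.add (((d3.const_mul 2).add (d2.const_mul (16 / w0 * s))).const_mul M)
      refine d.congr_deriv ?_
      simp only [hT, hm, Pi.add_apply, Pi.mul_apply, Pi.pow_apply]
      push_cast
      ring
    · simp only [hb1, hb2, hpper, hvper, hm, Real.cos_neg]
  have hWbd : ∀ x, ‖W x‖ ≤ MW := fun x => by
    rw [Real.norm_of_nonneg (hW0 x)]; exact hMW x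
  have iW : ∀ g : ℝ → ℝ, Continuous g →
      IntervalIntegrable (fun x => W x * g x) volume (-π) π := fun g hg =>
    bdd_mul_aux _ _ MW (hg.intervalIntegrable _ _) hWmeas hWbd
  have iW2 : IntervalIntegrable (fun x => W x * ‖u x‖ * ‖p x‖) volume (-π) π := by
    simpa [mul_assoc] using iW (fun x => ‖u x‖ * ‖p x‖) (by fun_prop)
  have iF : IntervalIntegrable (fun x => ‖f x‖ ^ 2) volume (-π) π := by
    have hfe : (fun x => ‖f x‖ ^ 2) = fun x =>
        ((r x).re ^ 2 + (r x).im ^ 2 + E ^ 2 * ((u x).re ^ 2 + (u x).im ^ 2)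
          + 2 * E * ((r x).re * (u x).re + (r x).im * (u x).im))
        + W x * (2 * q * ((r x).re * (u x).im - (r x).im * (u x).re))
        + W x * (W x * (q ^ 2 * ((u x).re ^ 2 + (u x).im ^ 2))) := by
      funext x
      rw [Complex.sq_norm, Complex.normSq_apply, hf x]
      simp
      ring
    rw [hfe]
    refine ((Continuous.intervalIntegrable (by fun_prop) _ _).add (iW _ (by fun_prop))).add ?_
    exact bdd_mul_aux _ _ MW (iW _ (by fun_prop)) hWmeas hWbd
  have iR := iF.add (iW2.const_mul q)
  set C := 8 * (6 * π) ^ 2 + 2 * (6 * π / X π) ^ 2 * (16 / w0 + 8) ^ 2 + 4 * (6 * π) with hC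
  have i1 := mu_integrable σ δ q (fun x => ‖p x‖ ^ 2) (by fun_prop)
  have i2 := mu_integrable σ δ q (fun x => ‖u x‖ ^ 2) (by fun_prop)
  have hpoint : ∀ x ∈ Set.Icc (-π) π,
      muFn σ δ q x * ‖p x‖ ^ 2 + E * (muFn σ δ q x * ‖u x‖ ^ 2) ≤
      2 * T x + C * (‖f x‖ ^ 2 + q * (W x * ‖u x‖ * ‖p x‖)) := by
    intro x hx
    have hmu : muFn σ δ q x ≤ ν x := mu_le σ δ q x hq
    have hE0 : 0 ≤ E := by linarith
    have h1 : muFn σ δ q x * ‖p x‖ ^ 2 + E * (muFn σ δ q x * ‖u x‖ ^ 2) ≤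
      ν x * ‖p x‖ ^ 2 + E * (ν x * ‖u x‖ ^ 2) := by gcongr
    refine h1.trans ?_
    refine pt_ineq (u x) (p x) (r x) (f x) q (W x) E s w0 (m x) (Real.sin x) (ν x) M _ (b x) _
      (hf x) hq (hW0 x) hs1 hsE hsq hw0 (hm0 x) ?_ (Real.abs_sin_le_one x) ?_ (hν1 x) hM0 hMx
      (hbB x hx)
    · refine max_le (by norm_num) ?_
      linarith [Real.cos_le_one s₀, Real.neg_one_le_cos x]
    · intro hmx
      have h2 : Real.cos x < Real.cos s₀ := by
        rcases lt_max_iff.1 hmx with h | h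
        · exact absurd h (lt_irrefl _)
        · linarith
      have h3 : s₀ < |x| := by
        by_contra hcon
        push Not at hcon
        have := Real.cos_le_cos_of_nonneg_of_le_pi (abs_nonneg x)
          (by rw [hs₀]; linarith : s₀ ≤ π) hcon
        rw [Real.cos_abs] at this
        linarith
      refine le_trans ?_ (hWV x hx).1
      have h4 : ¬ |x| ≤ σ := by
        have : σ < s₀ := by rw [hs₀]; linarith
        linarith
      rw [dampV, if_neg h4, hw0d]
      have h5 : 0 ≤ s₀ - σ := by rw [hs₀]; linarith
      gcongr
  have hint := intervalIntegral.integral_mono_on (by linarith : -π ≤ π)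
    (i1.add (i2.const_mul E))
    (((hTc.intervalIntegrable _ _).const_mul 2).add (iR.const_mul C)) hpoint
  rw [intervalIntegral.integral_add i1 (i2.const_mul E),
    intervalIntegral.integral_add ((hTc.intervalIntegrable _ _).const_mul 2) (iR.const_mul C),
    intervalIntegral.integral_const_mul, intervalIntegral.integral_const_mul,
    intervalIntegral.integral_const_mul, hT0,
    intervalIntegral.integral_add iF (iW2.const_mul q), intervalIntegral.integral_const_mul] at hint
  simpa using hint
end

section
/- Let δ = 1/(β+2), and for q > 0 define μ : [−π,π] → ℝ by μ(x) = q^δ if |x| ∈ [σ, σ + q^{−δ}] and μ(x) = 1 otherwise, and define χ : [−π,π] → ℝ by χ(x) = 0 for |x| ≤ σ, χ(x) = q^δ·(|x| − σ) for σ ≤ |x| ≤ σ + q^{−δ}, and χ(x) = 1 for σ + q^{−δ} ≤ |x| ≤ π. Then there exist constants E₀ > 0, C > 0, and q₀ > 0, depending only on C₀, σ, and β, such that for all q ≥ q₀, all real E with E₀ ≤ E ≤ q², and all u, f as in the context (i.e. u is 2π-periodic, twice continuously differentiable, and f = −u'' + i·q·W·u − E·u), one has ∫_{−π}^{π} μ·|u'|²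 + E·∫_{−π}^{π} μ·|u|² ≤ C·( (1 + E⁻¹·q^{2/(β+2)})·∫_{−π}^{π} |f|² + q^{1/2}·(∫_{−π}^{π} |f|·|u|)^{1/2}·(∫_{−π}^{π} W·χ·|f|·|u|)^{1/2} ). -/
open Real MeasureTheory intervalIntegral

/-- The cutoff `χ`: `0` for `|x| ≤ σ`, `q^δ (|x| - σ)` for `σ ≤ |x| ≤ σ + q^{-δ}`,
and `1` for `|x| ≥ σ + q^{-δ}`. -/
noncomputable def chiFn (σ δ q : ℝ) (x : ℝ) : ℝ :=
  if |x| ≤ σ then 0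
  else if |x| ≤ σ + q ^ (-δ) then q ^ δ * (|x| - σ)
  else 1



/-- measurable and bounded on the period -/
def BM (g : ℝ → ℝ) : Prop := Measurable g ∧ ∃ M, ∀ x ∈ Set.Icc (-π) π, |g x| ≤ M

lemma BM.ii {g : ℝ → ℝ} (h : BM g) : IntervalIntegrable g volume (-π) π := by
  obtain ⟨hm, M, hM⟩ := h
  have hp := Real.pi_pos
  rw [intervalIntegrable_iff_integrableOn_Icc_of_le (by linarith)]
  refine Measure.integrableOn_of_bounded (M := M) (by simp) hm.aestronglyMeasurable ?_
  filter_upwards [ae_restrict_mem measurableSet_Icc] with x hx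
  exact hM x hx

lemma BM.mul {g k : ℝ → ℝ} (hg : BM g) (hk : BM k) : BM (fun x => g x * k x) := by
  obtain ⟨hm, M, hM⟩ := hg
  obtain ⟨km, N, hN⟩ := hk
  refine ⟨hm.mul km, M * N, fun x hx => ?_⟩
  rw [abs_mul]
  exact mul_le_mul (hM x hx) (hN x hx) (abs_nonneg _) ((abs_nonneg _).trans (hM x hx))

lemma BM.add {g k : ℝ → ℝ} (hg : BM g) (hk : BM k) : BM (fun x => g x + k x) := by
  obtain ⟨hm, M, hM⟩ := hg
  obtain ⟨km, N, hN⟩ := hk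
  refine ⟨hm.add km, M + N, fun x hx => ?_⟩
  exact (abs_add_le _ _).trans (add_le_add (hM x hx) (hN x hx))

lemma BM.const (c : ℝ) : BM (fun _ => c) := ⟨measurable_const, |c|, fun _ _ => le_rfl⟩

lemma BM.cmul {g : ℝ → ℝ} (c : ℝ) (hg : BM g) : BM (fun x => c * g x) := (BM.const c).mul hg

lemma BM.sq {g : ℝ → ℝ} (hg : BM g) : BM (fun x => g x ^ 2) := by
  simp only [pow_two]; exact hg.mul hg

lemma BM.sub {g k : ℝ → ℝ} (hg : BM g) (hk : BM k) : BM (fun x => g x - k x) := by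
  have := hg.add (hk.cmul (-1))
  refine (iff_of_eq (congrArg BM ?_)).mp this
  funext x; ring

lemma BM.cont {g : ℝ → ℝ} (hg : Continuous g) : BM g := by
  refine ⟨hg.measurable, ?_⟩
  obtain ⟨M, hM⟩ := (isCompact_Icc (a := -π) (b := π)).exists_bound_of_continuousOn hg.continuousOn
  exact ⟨M, fun x hx => hM x hx⟩

lemma ftc_le (s : Set ℝ) (hs : s.Finite) (G G' Φ : ℝ → ℝ) (hc : Continuous G)
    (hd : ∀ x, x ∉ s → HasDerivAt G (G' x) x) (hper : G (-π) = G π)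
    (hG' : BM G') (hΦ : BM Φ) (hle : ∀ x ∈ Set.Icc (-π) π, x ∉ s → Φ x ≤ G' x) :
    ∫ x in (-π)..π, Φ x ≤ 0 := by
  have hp := Real.pi_pos
  have h1 : ∫ x in (-π)..π, G' x = G π - G (-π) :=
    MeasureTheory.integral_eq_of_hasDerivAt_off_countable G G' hs.countable hc.continuousOn
      (fun x hx => hd x hx.2) hG'.ii
  have h2 : ∫ x in (-π)..π, Φ x ≤ ∫ x in (-π)..π, G' x := by
    apply intervalIntegral.integral_mono_ae_restrict (by linarith) hΦ.ii hG'.ii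
    have : ∀ᵐ x ∂(volume : Measure ℝ), x ∉ s := by
      rw [ae_iff]; simpa using hs.measure_zero volume
    filter_upwards [ae_restrict_mem measurableSet_Icc, ae_restrict_of_ae this] with x hx hxs
    exact hle x hx hxs
  rw [h1, hper] at h2
  linarith

lemma mono_int {g k : ℝ → ℝ} (hg : BM g) (hk : BM k) (h : ∀ x ∈ Set.Icc (-π) π, g x ≤ k x) :
    ∫ x in (-π)..π, g x ≤ ∫ x in (-π)..π, k x :=
  intervalIntegral.integral_mono_on (by linarith [Real.pi_pos]) hg.ii hk.ii h

lemma nn_int {g : ℝ → ℝ} (h : ∀ x ∈ Set.Icc (-π) π, 0 ≤ g x) :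
    0 ≤ ∫ x in (-π)..π, g x :=
  intervalIntegral.integral_nonneg (by linarith [Real.pi_pos]) h

lemma cs_int {w g k : ℝ → ℝ} (hw : BM w) (hg : BM g) (hk : BM k)
    (h0 : ∀ x ∈ Set.Icc (-π) π, 0 ≤ w x) :
    (∫ x in (-π)..π, w x * (g x * k x)) ^ 2 ≤
      (∫ x in (-π)..π, w x * g x ^ 2) * ∫ x in (-π)..π, w x * k x ^ 2 := by
  have key : ∀ t : ℝ, 0 ≤ (∫ x in (-π)..π, w x * g x ^ 2) * (t * t) +
      (2 * ∫ x in (-π)..π, w x * (g x * k x)) * t + ∫ x in (-π)..π, w x * k x ^ 2 := by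
    intro t
    have h : 0 ≤ ∫ x in (-π)..π, ((t * t) * (w x * g x ^ 2) + (2 * t) * (w x * (g x * k x))
        + w x * k x ^ 2) := by
      apply nn_int
      intro x hx
      have := mul_nonneg (h0 x hx) (sq_nonneg (t * g x + k x))
      nlinarith
    rw [intervalIntegral.integral_add
      (((hw.mul hg.sq).cmul _).add ((hw.mul (hg.mul hk)).cmul _)).ii (hw.mul hk.sq).ii,
      intervalIntegral.integral_add ((hw.mul hg.sq).cmul _).ii ((hw.mul (hg.mul hk)).cmul _).ii,
      intervalIntegral.integral_const_mul, intervalIntegral.integral_const_mul] at h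
    linarith
  have := discrim_le_zero key
  unfold discrim at this
  nlinarith

/-- differential data -/
structure Sol (q E : ℝ) (W : ℝ → ℝ) (u d dd f : ℝ → ℂ) : Prop where
  hu : ∀ x, HasDerivAt u (d x) x
  hd : ∀ x, HasDerivAt d (dd x) x
  cu : Continuous u
  cd : Continuous d
  cdd : Continuous dd
  pu : u (-π) = u π
  pd : d (-π) = d π
  W0 : ∀ x, 0 ≤ W x
  bW : BM W
  eq : ∀ x, f x = -(dd x) + Complex.I * q * W x * u x - E * u x

open Complex in
lemma inn (w z : ℂ) : inner ℝ w z = w.re * z.re + w.im * z.im := by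
  rw [Complex.inner]; simp; ring

lemma Sol.bf {q E W u d dd f} (h : Sol q E W u d dd f) : BM (fun x => ‖f x‖) := by
  obtain ⟨M, hM⟩ := h.bW.2
  have hfm : Measurable f := by
    have : f = fun x => -(dd x) + Complex.I * q * W x * u x - E * u x := funext h.eq
    rw [this]
    have h1 := h.cdd.measurable
    have h2 := h.cu.measurable
    have h3 := Complex.measurable_ofReal.comp h.bW.1
    exact (h1.neg.add ((measurable_const.mul h3).mul h2)).sub (measurable_const.mul h2)
  refine ⟨hfm.norm, ?_⟩
  have b1 : BM (fun x => ‖dd x‖ + |q| * |W x| * ‖u x‖ + |E| * ‖u x‖) := by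
    have bu : BM (fun x => ‖u x‖) := .cont h.cu.norm
    have bd : BM (fun x => ‖dd x‖) := .cont h.cdd.norm
    have bw : BM (fun x => |W x|) := ⟨h.bW.1.abs, M, by simpa using hM⟩
    exact (bd.add ((bw.cmul _).mul bu)).add (bu.cmul _)
  obtain ⟨N, hN⟩ := b1.2
  refine ⟨N, fun x hx => le_trans ?_ (hN x hx)⟩
  rw [abs_norm, h.eq]
  refine le_trans ?_ (le_abs_self _)
  refine (norm_sub_le _ _).trans ?_
  refine add_le_add ((norm_add_le _ _).trans ?_) ?_
  · simp
  · simp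

lemma Sol.Q {q E W u d dd f} (h : Sol q E W u d dd f) :
    q * ∫ x in (-π)..π, W x * ‖u x‖ ^ 2 ≤ ∫ x in (-π)..π, ‖f x‖ * ‖u x‖ := by
  have bu : BM (fun x => ‖u x‖) := .cont h.cu.norm
  have key := ftc_le ∅ Set.finite_empty (fun x => inner ℝ (Complex.I * u x) (d x))
    (fun x => inner ℝ (Complex.I * u x) (dd x) + inner ℝ (Complex.I * d x) (d x))
    (fun x => q * (W x * ‖u x‖ ^ 2) - ‖f x‖ * ‖u x‖)
    ((continuous_const.mul h.cu).inner h.cd)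
    (fun x _ => ((h.hu x).const_mul Complex.I).inner ℝ (h.hd x))
    (by simp only [h.pu, h.pd])
    (.cont (((continuous_const.mul h.cu).inner h.cdd).add
      ((continuous_const.mul h.cd).inner h.cd)))
    (((h.bW.mul bu.sq).cmul _).sub (h.bf.mul bu))
    (fun x _ _ => by
      have e : inner ℝ (Complex.I * u x) (dd x) + inner ℝ (Complex.I * d x) (d x)
          = q * (W x * ‖u x‖ ^ 2) - inner ℝ (Complex.I * u x) (f x) := by
        rw [h.eq, ← Complex.normSq_eq_norm_sq, Complex.normSq_apply]
        simp only [inn]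
        simp
        ring
      have l := real_inner_le_norm (Complex.I * u x) (f x)
      simp only [norm_mul, Complex.norm_I, one_mul] at l
      simp only [e]; linarith)
  rw [intervalIntegral.integral_sub ((h.bW.mul bu.sq).cmul _).ii (h.bf.mul bu).ii,
    intervalIntegral.integral_const_mul] at key
  linarith

lemma Sol.H {q E W u d dd f} (h : Sol q E W u d dd f) (s : Set ℝ) (hs : s.Finite)
    (k k' : ℝ → ℝ) (ck : Continuous k) (bk' : BM k') (hk : ∀ x, x ∉ s → HasDerivAt k (k' x) x)
    (pk : k (-π) = k π) :
    ∫ x in (-π)..π, k x ^ 2 * ‖d x‖ ^ 2 ≤ 2 * (∫ x in (-π)..π, k x ^ 2 * (‖f x‖ * ‖u x‖))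
      + 2 * E * (∫ x in (-π)..π, k x ^ 2 * ‖u x‖ ^ 2) +
        4 * ∫ x in (-π)..π, k' x ^ 2 * ‖u x‖ ^ 2 := by
  have bu : BM (fun x => ‖u x‖) := .cont h.cu.norm
  have bd : BM (fun x => ‖d x‖) := .cont h.cd.norm
  have bk : BM k := .cont ck
  have b1 := (bk.sq.mul bd.sq)
  have b2 := (bk.sq.mul (h.bf.mul bu)).cmul 2
  have b3 := (bk.sq.mul bu.sq).cmul (2 * E)
  have b4 := (bk'.sq.mul bu.sq).cmul 4
  have key := ftc_le s hs (fun x => 2 * (k x ^ 2 * inner ℝ (u x) (d x)))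
    (fun x => 2 * ((2 * (k x * k' x)) * inner ℝ (u x) (d x) +
      k x ^ 2 * (inner ℝ (u x) (dd x) + inner ℝ (d x) (d x))))
    (fun x => k x ^ 2 * ‖d x‖ ^ 2 - 2 * (k x ^ 2 * (‖f x‖ * ‖u x‖)) -
      2 * E * (k x ^ 2 * ‖u x‖ ^ 2) - 4 * (k' x ^ 2 * ‖u x‖ ^ 2))
    (continuous_const.mul ((ck.pow 2).mul (h.cu.inner h.cd)))
    (fun x hx => by
      have := (((hk x hx).pow 2).mul ((h.hu x).inner ℝ (h.hd x))).const_mul 2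
      refine this.congr_deriv ?_
      simp only [Pi.pow_apply]
      push_cast
      ring)
    (by simp only [h.pu, h.pd, pk])
    ((((bk.mul bk').cmul 2).mul (.cont (h.cu.inner h.cd))).add
      (bk.sq.mul (.cont ((h.cu.inner h.cdd).add (h.cd.inner h.cd)))) |>.cmul 2)
    (((b1.sub b2).sub b3).sub b4)
    (fun x _ _ => by
      have e : inner ℝ (u x) (dd x) + inner ℝ (d x) (d x)
          = ‖d x‖ ^ 2 - E * ‖u x‖ ^ 2 - inner ℝ (u x) (f x) := by
        rw [h.eq, ← Complex.normSq_eq_norm_sq, ← Complex.normSq_eq_norm_sq, Complex.normSq_apply,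
          Complex.normSq_apply]
        simp only [inn]
        simp
        ring
      have l := real_inner_le_norm (u x) (f x)
      have l2 := abs_real_inner_le_norm (u x) (d x)
      simp only [e]
      have l3 : -(2 * (|k x| * ‖d x‖) * (|k' x| * ‖u x‖)) ≤ (2 * (k x * k' x)) * inner ℝ (u x) (d x) := by
        have : |(2 * (k x * k' x)) * inner ℝ (u x) (d x)| ≤ (2 * (|k x| * |k' x|)) * (‖u x‖ * ‖d x‖) := by
          rw [abs_mul, abs_mul, abs_mul, abs_two]
          gcongr
        have := neg_le_of_abs_le this
        linarith
      have l4 := mul_le_mul_of_nonneg_left l (sq_nonneg (k x))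
      have l5 := sq_nonneg (|k x| * ‖d x‖ - 2 * (|k' x| * ‖u x‖))
      have l6 : (|k x| * ‖d x‖) ^ 2 = k x ^ 2 * ‖d x‖ ^ 2 := by rw [mul_pow, sq_abs]
      have l7 : (|k' x| * ‖u x‖) ^ 2 = k' x ^ 2 * ‖u x‖ ^ 2 := by rw [mul_pow, sq_abs]
      nlinarith)
  rw [intervalIntegral.integral_sub ((b1.sub b2).sub b3).ii b4.ii,
    intervalIntegral.integral_sub (b1.sub b2).ii b3.ii,
    intervalIntegral.integral_sub b1.ii b2.ii,
    intervalIntegral.integral_const_mul, intervalIntegral.integral_const_mul,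
    intervalIntegral.integral_const_mul] at key
  linarith

lemma Sol.M {q E W u d dd f} (hE : 0 ≤ E) (hq : 0 ≤ q) (h : Sol q E W u d dd f)
    (s : Set ℝ) (hs : s.Finite)
    (b b' m N : ℝ → ℝ) (B m0 : ℝ) (cb : Continuous b) (bb' : BM b') (bm : BM m) (bN : BM N)
    (hb : ∀ x, x ∉ s → HasDerivAt b (b' x) x) (pb : b (-π) = b π)
    (hB : ∀ x ∈ Set.Icc (-π) π, |b x| ≤ B)
    (hm : ∀ x, x ∉ s → m x - m0 * N x ≤ b' x) :
    (∫ x in (-π)..π, m x * ‖d x‖ ^ 2) + E * (∫ x in (-π)..π, m x * ‖u x‖ ^ 2) ≤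
      2 * B * (∫ x in (-π)..π, 1 * (‖f x‖ * ‖d x‖)) + 2 * B * q * (∫ x in (-π)..π, W x * (‖u x‖ * ‖d x‖))
      + m0 * ((∫ x in (-π)..π, N x * ‖d x‖ ^ 2) + E * (∫ x in (-π)..π, N x * ‖u x‖ ^ 2)) := by
  have bu : BM (fun x => ‖u x‖) := .cont h.cu.norm
  have bd : BM (fun x => ‖d x‖) := .cont h.cd.norm
  have b1 := bm.mul bd.sq
  have b2 := (bm.mul bu.sq).cmul E
  have b3 := ((BM.const 1).mul (h.bf.mul bd)).cmul (2 * B)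
  have b4 := (h.bW.mul (bu.mul bd)).cmul (2 * B * q)
  have b5 := (bN.mul bd.sq).cmul m0
  have b6 := (bN.mul bu.sq).cmul (m0 * E)
  have key := ftc_le s hs (fun x => b x * (‖d x‖ ^ 2 + E * ‖u x‖ ^ 2))
    (fun x => b' x * (‖d x‖ ^ 2 + E * ‖u x‖ ^ 2) +
      b x * (2 * inner ℝ (d x) (dd x) + E * (2 * inner ℝ (u x) (d x))))
    (fun x => m x * ‖d x‖ ^ 2 + E * (m x * ‖u x‖ ^ 2) - 2 * B * (1 * (‖f x‖ * ‖d x‖))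
      - 2 * B * q * (W x * (‖u x‖ * ‖d x‖)) - m0 * (N x * ‖d x‖ ^ 2) - m0 * E * (N x * ‖u x‖ ^ 2))
    (cb.mul ((h.cd.norm.pow 2).add (continuous_const.mul (h.cu.norm.pow 2))))
    (fun x hx => (hb x hx).mul ((h.hd x).norm_sq.add ((h.hu x).norm_sq.const_mul E)))
    (by simp only [h.pu, h.pd, pb])
    ((bb'.mul (bd.sq.add (bu.sq.cmul _))).add ((BM.cont cb).mul (.cont
      ((continuous_const.mul (h.cd.inner h.cdd)).add
        (continuous_const.mul (continuous_const.mul (h.cu.inner h.cd)))))))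
    (((((b1.add b2).sub b3).sub b4).sub b5).sub b6)
    (fun x hx hxs => by
      have e : 2 * inner ℝ (d x) (dd x) + E * (2 * inner ℝ (u x) (d x))
          = 2 * inner ℝ (d x) (Complex.I * q * W x * u x - f x) := by
        rw [h.eq]
        simp only [inn]
        simp
        ring
      have l := abs_real_inner_le_norm (d x) (Complex.I * q * W x * u x - f x)
      have l1 : ‖Complex.I * q * W x * u x - f x‖ ≤ q * W x * ‖u x‖ + ‖f x‖ := by
        refine (norm_sub_le _ _).trans ?_
        simp [abs_of_nonneg hq, abs_of_nonneg (h.W0 x)]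
      simp only [e]
      have l2 : |b x * (2 * inner ℝ (d x) (Complex.I * q * W x * u x - f x))| ≤
          B * (2 * (‖d x‖ * (q * W x * ‖u x‖ + ‖f x‖))) := by
        rw [abs_mul, abs_mul, abs_two]
        have hb0 := hB x hx
        have : 0 ≤ B := (abs_nonneg _).trans hb0
        gcongr
        exact l.trans (by gcongr)
      have l3 := neg_le_of_abs_le l2
      have l4 : 0 ≤ ‖d x‖ ^ 2 + E * ‖u x‖ ^ 2 := by positivity
      have l5 := mul_le_mul_of_nonneg_right (hm x hxs) l4
      nlinarith)
  rw [intervalIntegral.integral_sub ((((b1.add b2).sub b3).sub b4).sub b5).ii b6.ii,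
    intervalIntegral.integral_sub (((b1.add b2).sub b3).sub b4).ii b5.ii,
    intervalIntegral.integral_sub ((b1.add b2).sub b3).ii b4.ii,
    intervalIntegral.integral_sub (b1.add b2).ii b3.ii,
    intervalIntegral.integral_add b1.ii b2.ii] at key
  simp only [one_mul, intervalIntegral.integral_const_mul] at key ⊢
  linarith

lemma pow_le_pow_left_aux {a b : ℝ} (h : a ^ 2 ≤ b ^ 2) (hb : 0 ≤ b) : a ≤ b := by nlinarith

set_option maxHeartbeats 2000000 in
lemma final_alg (C₀ B m K C1 C2 : ℝ) (hC₀ : 0 < C₀) (hB : 0 ≤ B) (hm : 0 ≤ m) (hK : 0 ≤ K)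
    (hC1 : 0 ≤ C1) (hC2 : 0 ≤ C2) : ∃ C > (0:ℝ), ∀ A T S Q H P Fd n2 U D Z Nn q E κ r : ℝ,
    0 ≤ A → 0 ≤ T → 0 ≤ S → 0 ≤ Q → 0 ≤ H → 0 ≤ P → 0 ≤ n2 → 0 ≤ Z → 1 ≤ q → 1 ≤ E → 1 ≤ κ →
    E ≤ q ^ 2 → κ ^ 2 ≤ q → q * r = κ →
    q * Q ≤ T → H ≤ 2 * C₀ * S + 2 * C₀ * E * Q + 4 * C1 * κ ^ 2 * Q →
    A ≤ 2 * B * Fd + 2 * B * q * P + m * Nn → Nn ≤ K * (H + E * Q) → P ^ 2 ≤ Q * Z →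
    Z ≤ C₀ * (H + r * A) → Fd ^ 2 ≤ n2 * D → T ^ 2 ≤ n2 * U → D ≤ A → E * U ≤ A → S ≤ C2 * T →
    A ≤ C * ((1 + E⁻¹ * κ ^ 2) * n2 + q ^ ((1:ℝ)/2) * T ^ ((1:ℝ)/2) * S ^ ((1:ℝ)/2)) := by
  set c : ℝ := C₀ * (2 * C₀ + 4 * C1 + 1) with hc
  set c' : ℝ := 2 * C₀ * C2 + (2 * C₀ + 1) + 4 * C1 with hc'
  set c2 : ℝ := 2 * B * √c with hc2
  set c3 : ℝ := 2 * B + c2 + c2 ^ 2 + m * K * c' with hc3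
  have hcp : 0 ≤ c := by positivity
  have hccp : 0 ≤ c' := by positivity
  have hc2p : 0 ≤ c2 := by positivity
  have hc3p : 0 ≤ c3 := by positivity
  refine ⟨4 * c3 ^ 2 + 2 * c2 + 1, by positivity, ?_⟩
  intro A T S Q H P Fd n2 U D Z Nn q E κ r hA hT hS hQ hH hP hn2 hZ hq hE hκ hEq hκq hr h1 h2 h3 h4
    h5 h6 h7 h8 h9 h10 h11
  rw [← sqrt_eq_rpow, ← sqrt_eq_rpow, ← sqrt_eq_rpow]
  set X := √q * √T * √S with hX
  set n := √n2
  set a := √A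
  set e := √E
  have hXp : 0 ≤ X := by positivity
  have sX : X ^ 2 = q * T * S := by
    rw [hX, mul_pow, mul_pow, sq_sqrt hT, sq_sqrt hS, sq_sqrt (by linarith)]
  have hn : 0 ≤ n := by positivity
  have ha : 0 ≤ a := by positivity
  have sn : n ^ 2 = n2 := sq_sqrt hn2
  have sa : a ^ 2 = A := sq_sqrt hA
  have se : e ^ 2 = E := sq_sqrt (by linarith)
  have he : 1 ≤ e := Real.one_le_sqrt.mpr hE
  clear_value X n a e
  set y := (1 + κ / e) * n with hy
  have hy0 : 0 ≤ y := by positivity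
  have hny : n ≤ y := by
    rw [hy]; have : 0 ≤ κ / e * n := by positivity
    linarith
  have heT : e * T ≤ n * a := by
    refine pow_le_pow_left_aux ?_ (by positivity)
    rw [mul_pow, mul_pow, se, sn, sa]
    calc E * T ^ 2 ≤ E * (n2 * U) := by gcongr
      _ = n2 * (E * U) := by ring
      _ ≤ _ := by gcongr
  have hκT : κ * T ≤ y * a := by
    have : κ * T = κ / e * (e * T) := by field_simp
    rw [this, hy]
    have h : κ / e * (e * T) ≤ κ / e * (n * a) := by gcongr
    have : 0 ≤ n * a := by positivity
    calc _ ≤ _ := h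
      _ ≤ n * a + κ / e * (n * a) := by linarith
      _ = _ := by ring
  have heTy : e * T ≤ y * a := heT.trans (by gcongr)
  have hFd : Fd ≤ n * a := by
    refine pow_le_pow_left_aux ?_ (by positivity)
    rw [mul_pow, sn, sa]
    exact h7.trans (by gcongr)
  have heq : e ≤ q := by
    refine pow_le_pow_left_aux ?_ (by linarith); rw [se]; exact hEq
  -- bound of E Q and κ² Q
  have hEQ : E * Q ≤ e * T := by
    have : e * Q ≤ T := le_trans (by gcongr) h1
    rw [← se]; nlinarith
  have hTe : T ≤ e * T := by nlinarith
  have hκQ : κ ^ 2 * Q ≤ e * T := by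
    have : κ ^ 2 * Q ≤ T := le_trans (by gcongr) h1
    linarith
  have hSe : S ≤ C2 * (e * T) := h11.trans (by gcongr)
  have hHEQ : H + E * Q ≤ c' * (y * a) := by
    have : H + E * Q ≤ c' * (e * T) := by
      rw [hc']
      have a1 := mul_le_mul_of_nonneg_left hSe hC₀.le
      have a2 := mul_le_mul_of_nonneg_left hEQ hC₀.le
      have a3 := mul_le_mul_of_nonneg_left hκQ hC1
      linarith
    exact this.trans (by gcongr)
  have hN : m * Nn ≤ m * K * c' * (y * a) := by
    have := mul_le_mul_of_nonneg_left (h4.trans (mul_le_mul_of_nonneg_left hHEQ hK)) hm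
    linarith
  -- q P
  have hqH : q * H ≤ 2 * C₀ * (q * S) + 2 * C₀ * (E * T) + 4 * C1 * (κ ^ 2 * T) := by
    have a0 := mul_le_mul_of_nonneg_left h2 (show 0 ≤ q by linarith)
    have a1 := mul_le_mul_of_nonneg_left h1 (show 0 ≤ 2 * C₀ * E by positivity)
    have a2 := mul_le_mul_of_nonneg_left h1 (show 0 ≤ 4 * C1 * κ ^ 2 by positivity)
    linarith
  have hqZ : q * Z ≤ C₀ * (2 * C₀ * (q * S) + 2 * C₀ * (E * T) + 4 * C1 * (κ ^ 2 * T) + κ * A) := by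
    calc q * Z ≤ q * (C₀ * (H + r * A)) := by gcongr
      _ = C₀ * (q * H + (q * r) * A) := by ring
      _ ≤ _ := by rw [hr]; gcongr
  have hqP : (q * P) ^ 2 ≤ c * (X ^ 2 + (y * a) ^ 2 + (y * a) * a ^ 2) := by
    have b1 : (q * P) ^ 2 ≤ T * (q * Z) := by
      calc (q * P) ^ 2 = q ^ 2 * P ^ 2 := by ring
        _ ≤ q ^ 2 * (Q * Z) := by gcongr
        _ = (q * Q) * (q * Z) := by ring
        _ ≤ _ := by gcongr
    have b2 : T * (q * Z) ≤ C₀ * (2 * C₀ * X ^ 2 + 2 * C₀ * (e * T) ^ 2 + 4 * C1 * (κ * T) ^ 2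
        + (κ * T) * A) := by
      refine (mul_le_mul_of_nonneg_left hqZ hT).trans (le_of_eq ?_)
      rw [sX, ← se]; ring
    have b3 : (e * T) ^ 2 ≤ (y * a) ^ 2 := by gcongr
    have b4 : (κ * T) ^ 2 ≤ (y * a) ^ 2 := by gcongr
    have b5 : (κ * T) * A ≤ (y * a) * a ^ 2 := by rw [sa]; gcongr
    refine b1.trans (b2.trans ?_)
    rw [hc, mul_assoc C₀]
    refine mul_le_mul_of_nonneg_left ?_ hC₀.le
    have z1 := mul_le_mul_of_nonneg_left b3 hC₀.le
    have z2 := mul_le_mul_of_nonneg_left b4 hC1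
    have z3 : 0 ≤ (y * a) * a ^ 2 := by positivity
    have z4 := mul_nonneg hC₀.le z3
    have z5 := mul_nonneg hC1 z3
    have z6 := mul_nonneg hC1 (sq_nonneg X)
    have z7 := sq_nonneg (y * a)
    have z8 := sq_nonneg X
    linarith
  set w := √(y * a) with hw
  have sw : w ^ 2 = y * a := sq_sqrt (by positivity)
  have hw0 : 0 ≤ w := by positivity
  have hqP2 : q * P ≤ √c * (X + y * a + w * a) := by
    refine pow_le_pow_left_aux ?_ (by positivity)
    rw [mul_pow (√c), sq_sqrt hcp]
    refine hqP.trans ?_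
    refine mul_le_mul_of_nonneg_left ?_ hcp
    have : (y * a) * a ^ 2 = (w * a) ^ 2 := by rw [mul_pow, sw]
    rw [this]
    have := mul_nonneg hXp (show 0 ≤ y * a by positivity)
    have := mul_nonneg hXp (show 0 ≤ w * a by positivity)
    have := mul_nonneg (show 0 ≤ w * a by positivity) (show 0 ≤ y * a by positivity)
    linarith
  have t1 : 2 * B * q * P ≤ c2 * (X + y * a + w * a) := by
    have := mul_le_mul_of_nonneg_left hqP2 (show 0 ≤ 2 * B by positivity)
    rw [hc2]; linarith
  have t2 : c2 * (w * a) ≤ a ^ 2 / 4 + c2 ^ 2 * (y * a) := by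
    rw [← sw]; have := sq_nonneg (a / 2 - c2 * w); linarith
  have t3 : 2 * B * Fd ≤ 2 * B * (y * a) := by
    have : Fd ≤ y * a := hFd.trans (by gcongr)
    gcongr
  have t4 : a ^ 2 ≤ c3 * (y * a) + c2 * X + a ^ 2 / 4 := by
    rw [hc3, sa]; rw [sa] at t2; linarith
  have t5 : c3 * (y * a) ≤ a ^ 2 / 4 + c3 ^ 2 * y ^ 2 := by
    have := sq_nonneg (a / 2 - c3 * y); linarith
  have t6 : y ^ 2 ≤ 2 * ((1 + E⁻¹ * κ ^ 2) * n2) := by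
    have : E⁻¹ * κ ^ 2 = (κ / e) ^ 2 := by rw [div_pow, se]; ring
    rw [this, hy, mul_pow, sn, ← mul_assoc]
    gcongr
    have := sq_nonneg (1 - κ / e); linarith
  have t7 : 0 ≤ (1 + E⁻¹ * κ ^ 2) * n2 := by positivity
  have t8 := mul_le_mul_of_nonneg_left t6 (sq_nonneg c3)
  rw [← sa]
  have t9 : 0 ≤ c3 ^ 2 * X := by positivity
  have t10 : 0 ≤ c2 * ((1 + E⁻¹ * κ ^ 2) * n2) := by positivity
  linarith

/-- ramp -/
noncomputable def rampF (a x : ℝ) : ℝ := max (x - a) 0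
/-- step -/
noncomputable def stepF (a x : ℝ) : ℝ := if a < x then 1 else 0

lemma ramp_cont (a : ℝ) : Continuous (rampF a) := by unfold rampF; fun_prop
lemma step_meas (a : ℝ) : Measurable (stepF a) :=
  Measurable.ite measurableSet_Ioi measurable_const measurable_const
lemma ramp_deriv (a x : ℝ) (h : x ≠ a) : HasDerivAt (rampF a) (stepF a x) x := by
  rcases lt_or_gt_of_ne h with h | h
  · have : stepF a x = 0 := by simp [stepF, h.le]
    rw [this]
    refine (hasDerivAt_const x (0:ℝ)).congr_of_eventuallyEq ?_
    filter_upwards [Iio_mem_nhds h] with y hy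
    exact max_eq_right (by have : y < a := hy; linarith)
  · have : stepF a x = 1 := by simp [stepF, h]
    rw [this]
    refine ((hasDerivAt_id x).sub_const a).congr_of_eventuallyEq ?_
    filter_upwards [Ioi_mem_nhds h] with y hy
    exact max_eq_left (by have : a < y := hy; linarith)

lemma step_bm (a : ℝ) : BM (stepF a) :=
  ⟨step_meas a, 1, fun x _ => by unfold stepF; split_ifs <;> simp⟩

lemma BM.neg {g : ℝ → ℝ} (h : BM g) : BM (fun x => g (-x)) := by
  obtain ⟨hm, M, hM⟩ := h
  exact ⟨hm.comp measurable_neg, M, fun x hx => hM (-x) ⟨by linarith [hx.2], by linarith [hx.1]⟩⟩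

/-- The Morawetz multiplier. -/
lemma exists_b (σ κ τ : ℝ) (δ q : ℝ) (hσ : 0 < σ) (hσπ : σ < π) (hκ : 1 ≤ κ) (hτ : 0 < τ)
    (hκτ : κ * τ = 1) (hτL : τ ≤ (π - σ) / 2) (hκd : κ = q ^ δ) (hτd : τ = q ^ (-δ)) :
    ∃ (s : Set ℝ) (b b' : ℝ → ℝ), s.Finite ∧ Continuous b ∧ BM b' ∧
      (∀ x, x ∉ s → HasDerivAt b (b' x) x) ∧ b (-π) = b π ∧
      (∀ x ∈ Set.Icc (-π) π, |b x| ≤ π + 1 + 2 * (π + 1) / (π - σ) * π) ∧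
      (∀ x, x ∉ s → muFn σ δ q x - 2 * (π + 1) / (π - σ) *
        (if (σ + π) / 2 < |x| then 1 else 0) ≤ b' x) := by
  have hp := Real.pi_pos
  set x0 := (σ + π) / 2 with hx0
  set m := 2 * (π + 1 - τ) / (π - σ) with hm
  have hL : 0 < π - σ := by linarith
  have hm0 : 0 ≤ m := by rw [hm]; apply div_nonneg <;> linarith
  have hmM : m ≤ 2 * (π + 1) / (π - σ) := by rw [hm]; gcongr; linarith
  have hmL : m * (π - σ) = 2 * (π + 1 - τ) := by rw [hm]; field_simp
  set M := 2 * (π + 1) / (π - σ) with hM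
  clear_value M m
  set P : ℝ → ℝ := fun x => x / 2 + (κ - 1) * (rampF σ x - rampF (σ + τ) x) - m * rampF x0 x with hP
  set P' : ℝ → ℝ := fun x => 1 / 2 + (κ - 1) * (stepF σ x - stepF (σ + τ) x) - m * stepF x0 x with hP'
  have cP : Continuous P := by
    have := ramp_cont σ; have := ramp_cont (σ + τ); have := ramp_cont x0
    rw [hP]; fun_prop
  have bP' : BM P' :=
    ((BM.const _).add (((step_bm σ).sub (step_bm (σ + τ))).cmul _)).sub ((step_bm x0).cmul _)
  have dP : ∀ x, x ≠ σ → x ≠ σ + τ → x ≠ x0 → HasDerivAt P (P' x) x := by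
    intro x h1 h2 h3
    exact (((hasDerivAt_id x).div_const 2).add (((ramp_deriv σ x h1).sub
      (ramp_deriv (σ + τ) x h2)).const_mul (κ - 1))).sub ((ramp_deriv x0 x h3).const_mul m)
  refine ⟨{σ, σ + τ, x0, -σ, -(σ + τ), -x0}, fun x => P x - P (-x), fun x => P' x + P' (-x),
    by simp, cP.sub (cP.comp continuous_neg), bP'.add bP'.neg, ?_, ?_, ?_, ?_⟩
  · intro x hx
    simp only [Set.mem_insert_iff, Set.mem_singleton_iff, not_or] at hx
    obtain ⟨h1, h2, h3, h4, h5, h6⟩ := hx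
    have d1 := dP x h1 h2 h3
    have d2 := dP (-x) (fun h => h4 (by linarith)) (fun h => h5 (by linarith))
      (fun h => h6 (by linarith))
    have := d1.sub (d2.comp x (hasDerivAt_neg x))
    refine this.congr_deriv ?_
    ring
  · have : P π - P (-π) = 0 := by
      simp only [hP, rampF]
      rw [max_eq_left (by linarith), max_eq_left (by linarith), max_eq_left (by linarith),
        max_eq_right (by linarith), max_eq_right (by linarith), max_eq_right (by linarith)]
      rw [hx0]; linear_combination hκτ - hmL / 2
    simp only [neg_neg]; linarith
  · have key : ∀ x ∈ Set.Icc 0 π, |P x - P (-x)| ≤ π + 1 + M * π := by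
      rintro x ⟨hx1, hx2⟩
      have e : P x - P (-x) = x + (κ - 1) * (rampF σ x - rampF (σ + τ) x) - m * rampF x0 x := by
        simp only [hP]
        have e1 : rampF σ (-x) = 0 := max_eq_right (by linarith)
        have e2 : rampF (σ + τ) (-x) = 0 := max_eq_right (by linarith)
        have e3 : rampF x0 (-x) = 0 := max_eq_right (by linarith)
        rw [e1, e2, e3]; ring
      have r1 : 0 ≤ rampF σ x - rampF (σ + τ) x := by
        unfold rampF; have := max_le_max_right 0 (show x - (σ + τ) ≤ x - σ by linarith); linarith
      have r2 : rampF σ x - rampF (σ + τ) x ≤ τ := by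
        unfold rampF
        have := le_max_left (x - (σ + τ)) 0
        have := le_max_right (x - (σ + τ)) 0
        have : max (x - σ) 0 ≤ max (x - (σ + τ)) 0 + τ := max_le (by linarith) (by linarith)
        linarith
      have r3 : 0 ≤ rampF x0 x := le_max_right _ _
      have r4 : rampF x0 x ≤ π := max_le (by linarith) hp.le
      have s1 : (κ - 1) * (rampF σ x - rampF (σ + τ) x) ≤ 1 := by
        have := mul_le_mul_of_nonneg_left r2 (show 0 ≤ κ - 1 by linarith)
        linarith
      have s2 := mul_nonneg (show 0 ≤ κ - 1 by linarith) r1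
      have s3 : m * rampF x0 x ≤ M * π := by gcongr; linarith
      have s4 := mul_nonneg hm0 r3
      rw [e, abs_le]
      constructor <;> linarith
    intro x hx
    rcases le_total 0 x with h | h
    · exact key x ⟨h, hx.2⟩
    · have := key (-x) ⟨by linarith, by linarith [hx.1]⟩
      rw [neg_neg, abs_sub_comm] at this
      exact this
  · have key : ∀ x, 0 ≤ x → x ≠ σ → x ≠ σ + τ → muFn σ δ q x - M * (if x0 < |x| then 1 else 0)
        ≤ P' x + P' (-x) := by
      intro x hx h1 h2
      have e1 : stepF σ (-x) = 0 := if_neg (by linarith)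
      have e2 : stepF (σ + τ) (-x) = 0 := if_neg (by linarith)
      have e3 : stepF x0 (-x) = 0 := if_neg (by linarith)
      have e : P' x + P' (-x) = 1 + (κ - 1) * (stepF σ x - stepF (σ + τ) x) - m * stepF x0 x := by
        simp only [hP', e1, e2, e3]; ring
      rw [e]
      have e4 : M * (if x0 < |x| then 1 else 0) ≥ m * stepF x0 x := by
        rw [abs_of_nonneg hx]; unfold stepF; split_ifs <;> simp [hmM]
      have e5 : muFn σ δ q x = 1 + (κ - 1) * (stepF σ x - stepF (σ + τ) x) := by
        unfold muFn stepF
        rw [abs_of_nonneg hx, ← hκd, ← hτd]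
        rcases lt_or_gt_of_ne h1 with h | h
        · rw [if_neg (by intro h'; linarith [h'.1]), if_neg (by linarith), if_neg (by linarith)]
          ring
        · rcases lt_or_gt_of_ne h2 with h' | h'
          · rw [if_pos ⟨h.le, h'.le⟩, if_pos h, if_neg (by linarith)]; ring
          · rw [if_neg (by intro h''; linarith [h''.2]), if_pos h, if_pos h']; ring
      linarith
    intro x hx
    simp only [Set.mem_insert_iff, Set.mem_singleton_iff, not_or] at hx
    obtain ⟨h1, h2, h3, h4, h5, h6⟩ := hx
    rcases le_total 0 x with h | h
    · exact key x h h1 h2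
    · have := key (-x) (by linarith) (fun h => h4 (by linarith)) (fun h => h5 (by linarith))
      have e : muFn σ δ q (-x) = muFn σ δ q x := by simp [muFn]
      rw [neg_neg, e, abs_neg] at this
      linarith

/-- one-sided damping multiplier -/
noncomputable def kF (σ β κ x : ℝ) : ℝ := (rampF σ x) ^ (β / 2) * min (κ * rampF σ x) 1
/-- its derivative -/
noncomputable def kF' (σ β κ τ x : ℝ) : ℝ :=
  if x ≤ σ then 0 else if x ≤ σ + τ then (β / 2 + 1) * κ * (x - σ) ^ (β / 2)
  else (β / 2) * (x - σ) ^ (β / 2 - 1)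

lemma exists_h (σ β κ τ : ℝ) (δ q : ℝ) (hσ : 0 < σ) (hβ : 0 ≤ β) (hκ : 1 ≤ κ)
    (hτ : 0 < τ)
    (hκτ : κ * τ = 1) (hκd : κ = q ^ δ) (hτd : τ = q ^ (-δ)) :
    ∃ (s : Set ℝ) (k k' : ℝ → ℝ), s.Finite ∧ Continuous k ∧ BM k' ∧
      (∀ x, x ∉ s → HasDerivAt k (k' x) x) ∧ k (-π) = k π ∧
      (∀ x, k x ^ 2 = dampV σ β x * chiFn σ δ q x ^ 2) ∧
      (∀ x, k' x ^ 2 ≤ (β / 2 + 1) ^ 2 * κ ^ 2 * dampV σ β x) := by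
  have hp := Real.pi_pos
  have k0 : ∀ x, x ≤ σ → kF σ β κ x = 0 := by
    intro x hx
    have : rampF σ x = 0 := max_eq_right (by linarith)
    simp [kF, this]
  have k1 : ∀ x, σ < x → x ≤ σ + τ → kF σ β κ x = κ * (x - σ) ^ (β / 2 + 1) := by
    intro x hx hx2
    have : rampF σ x = x - σ := max_eq_left (by linarith)
    rw [kF, this, min_eq_left, rpow_add_one (by linarith)]
    · ring
    · rw [← hκτ]; gcongr; linarith
  have k2 : ∀ x, σ + τ ≤ x → kF σ β κ x = (x - σ) ^ (β / 2) := by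
    intro x hx
    have : rampF σ x = x - σ := max_eq_left (by linarith)
    rw [kF, this, min_eq_right, mul_one]
    · rw [← hκτ]; gcongr; linarith
  have ck : Continuous (kF σ β κ) := by
    have := ramp_cont σ
    unfold kF
    exact (this.rpow_const (fun x => Or.inr (by linarith))).mul
      ((continuous_const.mul this).min continuous_const)
  have dk : ∀ x, x ≠ σ → x ≠ σ + τ → HasDerivAt (kF σ β κ) (kF' σ β κ τ x) x := by
    intro x h1 h2
    rcases lt_or_gt_of_ne h1 with h | h
    · rw [kF', if_pos h.le]
      refine (hasDerivAt_const x (0:ℝ)).congr_of_eventuallyEq ?_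
      filter_upwards [Iio_mem_nhds h] with y hy
      exact k0 y (le_of_lt hy)
    · rcases lt_or_gt_of_ne h2 with h' | h'
      · rw [kF', if_neg (by linarith), if_pos h'.le]
        have := ((((hasDerivAt_id x).sub_const σ).rpow_const (p := β / 2 + 1)
          (Or.inl (by simp only [id]; linarith))).const_mul κ)
        have := this.congr_of_eventuallyEq (f₁ := kF σ β κ) (by
          filter_upwards [Ioo_mem_nhds h h'] with y hy
          exact k1 y hy.1 hy.2.le)
        refine this.congr_deriv ?_
        simp only [id, add_sub_cancel_right]; ring
      · rw [kF', if_neg (by linarith), if_neg (by linarith)]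
        have := (((hasDerivAt_id x).sub_const σ).rpow_const (p := β / 2)
          (Or.inl (by simp only [id]; linarith)))
        have := this.congr_of_eventuallyEq (f₁ := kF σ β κ) (by
          filter_upwards [Ioi_mem_nhds h'] with y hy
          exact k2 y (le_of_lt hy))
        refine this.congr_deriv ?_
        simp only [id]; ring
  have mk' : Measurable (kF' σ β κ τ) := by
    unfold kF'
    refine Measurable.ite measurableSet_Iic measurable_const
      (Measurable.ite measurableSet_Iic ?_ ?_) <;> fun_prop
  have bd : ∀ x, σ < x → |kF' σ β κ τ x| ≤ (β / 2 + 1) * κ * (x - σ) ^ (β / 2) := by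
    intro x hx
    have hs : 0 < x - σ := by linarith
    have h0 : 0 ≤ kF' σ β κ τ x := by
      unfold kF'; split_ifs <;> positivity
    rw [abs_of_nonneg h0, kF', if_neg (by linarith)]
    split_ifs with h
    · exact le_rfl
    · rw [rpow_sub_one (by linarith)]
      have : 1 / (x - σ) ≤ κ := by
        rw [div_le_iff₀ hs, ← hκτ]; gcongr; linarith
      have hpw : 0 ≤ (x - σ) ^ (β / 2) := by positivity
      calc β / 2 * ((x - σ) ^ (β / 2) / (x - σ)) = β / 2 * (1 / (x - σ)) * (x - σ) ^ (β / 2) := by ring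
        _ ≤ (β / 2 + 1) * κ * (x - σ) ^ (β / 2) := by gcongr; linarith
  have bk' : BM (kF' σ β κ τ) := by
    refine ⟨mk', (β / 2 + 1) * κ * π ^ (β / 2), fun x hx => ?_⟩
    rcases le_or_gt x σ with h | h
    · rw [kF', if_pos h, abs_zero]; positivity
    · have hs : 0 ≤ x - σ := by linarith
      refine (bd x h).trans ?_
      gcongr
      linarith [hx.2]
  refine ⟨{σ, σ + τ, -σ, -(σ + τ)}, fun x => kF σ β κ x + kF σ β κ (-x),
    fun x => kF' σ β κ τ x - kF' σ β κ τ (-x), by simp, ck.add (ck.comp continuous_neg),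
    bk'.sub bk'.neg, ?_, ?_, ?_, ?_⟩
  · intro x hx
    simp only [Set.mem_insert_iff, Set.mem_singleton_iff, not_or] at hx
    obtain ⟨h1, h2, h4, h5⟩ := hx
    have d1 := dk x h1 h2
    have d2 := dk (-x) (fun h => h4 (by linarith)) (fun h => h5 (by linarith))
    have := d1.add (d2.comp x (hasDerivAt_neg x))
    refine this.congr_deriv ?_
    ring
  · simp only [neg_neg]; ring
  · have key : ∀ x, 0 ≤ x → (kF σ β κ x + kF σ β κ (-x)) ^ 2
        = dampV σ β x * chiFn σ δ q x ^ 2 := by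
      intro x hx
      rw [k0 (-x) (by linarith), add_zero]
      unfold dampV chiFn
      rw [abs_of_nonneg hx, ← hκd, ← hτd]
      split_ifs with h h'
      · simp [k0 x h]
      · have hs : 0 < x - σ := by linarith
        rw [k1 x (by linarith) h', rpow_add_one (by linarith)]
        have : (x - σ) ^ β = ((x - σ) ^ (β / 2)) ^ 2 := by
          rw [← rpow_natCast, ← rpow_mul hs.le]; congr 1; push_cast; ring
        rw [this]; ring
      · have hs : 0 < x - σ := by linarith
        rw [k2 x (by linarith)]
        have : (x - σ) ^ β = ((x - σ) ^ (β / 2)) ^ 2 := by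
          rw [← rpow_natCast, ← rpow_mul hs.le]; congr 1; push_cast; ring
        rw [this]; ring
    intro x
    rcases le_total 0 x with h | h
    · exact key x h
    · have := key (-x) (by linarith)
      have e : chiFn σ δ q (-x) = chiFn σ δ q x := by simp [chiFn]
      have e' : dampV σ β (-x) = dampV σ β x := by simp [dampV]
      rw [neg_neg, e, e'] at this
      rw [← this]; ring
  · have key : ∀ x, 0 ≤ x → (kF' σ β κ τ x - kF' σ β κ τ (-x)) ^ 2 ≤
        (β / 2 + 1) ^ 2 * κ ^ 2 * dampV σ β x := by
      intro x hx
      have : kF' σ β κ τ (-x) = 0 := if_pos (by linarith)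
      rw [this, sub_zero]
      unfold dampV
      rw [abs_of_nonneg hx]
      split_ifs with h
      · rw [kF', if_pos h]; simp
      · have hs : 0 < x - σ := by linarith
        have e : (x - σ) ^ β = ((x - σ) ^ (β / 2)) ^ 2 := by
          rw [← rpow_natCast, ← rpow_mul hs.le]; congr 1; push_cast; ring
        rw [e, ← mul_pow, ← mul_pow, ← sq_abs]
        have := bd x (by linarith)
        gcongr
    intro x
    rcases le_total 0 x with h | h
    · exact key x h
    · have := key (-x) (by linarith)
      have e' : dampV σ β (-x) = dampV σ β x := by simp [dampV]
      rw [neg_neg, e'] at this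
      rw [← neg_sub, neg_sq] at this
      exact this

lemma mu_bm (σ δ q : ℝ) : BM (muFn σ δ q) := by
  refine ⟨?_, |q ^ δ| + 1, fun x _ => ?_⟩
  · unfold muFn
    refine Measurable.ite ?_ measurable_const measurable_const
    exact (measurableSet_le measurable_const continuous_abs.measurable).inter
      (measurableSet_le continuous_abs.measurable measurable_const)
  · unfold muFn
    split_ifs
    · linarith
    · rw [abs_one]; linarith [abs_nonneg (q ^ δ)]

lemma chi_01 (σ δ q : ℝ) (hq : 0 < q) (x : ℝ) : 0 ≤ chiFn σ δ q x ∧ chiFn σ δ q x ≤ 1 := by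
  unfold chiFn
  split_ifs with h h'
  · simp
  · have hk : 0 < q ^ δ := by positivity
    have e : q ^ δ * q ^ (-δ) = 1 := by rw [← rpow_add hq]; simp
    constructor
    · have : 0 < |x| - σ := by linarith
      positivity
    · rw [← e]; gcongr; linarith
  · simp

lemma chi_bm (σ δ q : ℝ) (hq : 0 < q) : BM (chiFn σ δ q) := by
  refine ⟨?_, 1, fun x _ => ?_⟩
  · unfold chiFn
    refine Measurable.ite (measurableSet_le continuous_abs.measurable measurable_const)
      measurable_const (Measurable.ite
        (measurableSet_le continuous_abs.measurable measurable_const) ?_ measurable_const)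
    have : Continuous fun x : ℝ => q ^ δ * (|x| - σ) := by fun_prop
    exact this.measurable
  · obtain ⟨h0, h1⟩ := chi_01 σ δ q hq x
    rw [abs_of_nonneg h0]; exact h1

lemma dampV_nn (σ β x : ℝ) : 0 ≤ dampV σ β x := by
  unfold dampV
  split_ifs with h
  · exact le_rfl
  · have : 0 < |x| - σ := by linarith
    positivity

set_option maxHeartbeats 2000000 in
/-- Lemma 3 (with `δ = 1/(β+2)`):
`∫ μ |u'|² + E ∫ μ |u|² ≲ (1 + E⁻¹ q^{2/(β+2)}) ∫ |f|²
  + q^{1/2} (∫ |f||u|)^{1/2} (∫ W χ |f||u|)^{1/2}`. -/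
theorem damped_wave_mu_chi_estimate
    (C₀ σ β : ℝ) (hC₀ : 0 < C₀) (hσ : σ ∈ Set.Ioo 0 π) (hβ : 0 ≤ β) :
    ∃ E₀ > (0 : ℝ), ∃ C > (0 : ℝ), ∃ q₀ > (0 : ℝ),
      ∀ (W : ℝ → ℝ), Function.Periodic W (2 * π) → Measurable W →
        (∃ M : ℝ, ∀ x : ℝ, W x ≤ M) → (∀ x : ℝ, 0 ≤ W x) →
        (∀ x ∈ Set.Icc (-π) π,
          dampV σ β x / C₀ ≤ W x ∧ W x ≤ C₀ * dampV σ β x) →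
        ∀ q ≥ q₀, ∀ E : ℝ, E₀ ≤ E → E ≤ q ^ 2 →
          ∀ (u f : ℝ → ℂ), ContDiff ℝ 2 u → Function.Periodic u (2 * π) →
            (∀ x : ℝ,
              f x = -(deriv (deriv u) x) + Complex.I * q * W x * u x - E * u x) →
            (∫ x in (-π)..π, muFn σ (1 / (β + 2)) q x * ‖deriv u x‖ ^ 2) +
                E * ∫ x in (-π)..π, muFn σ (1 / (β + 2)) q x * ‖u x‖ ^ 2 ≤
              C * ((1 + E⁻¹ * q ^ ((2 : ℝ) / (β + 2))) *
                    (∫ x in (-π)..π, ‖f x‖ ^ 2) +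
                q ^ ((1 : ℝ) / 2) *
                  (∫ x in (-π)..π, ‖f x‖ * ‖u x‖) ^ ((1 : ℝ) / 2) *
                  (∫ x in (-π)..π,
                    W x * chiFn σ (1 / (β + 2)) q x * ‖f x‖ * ‖u x‖) ^
                    ((1 : ℝ) / 2)) := by
  obtain ⟨hσ0, hσπ⟩ := hσ
  have hp := Real.pi_pos
  have hL : 0 < π - σ := by linarith
  set v : ℝ := ((π - σ) / 2) ^ β with hv
  have hv0 : 0 < v := by positivity
  obtain ⟨C, hC, hfin⟩ := final_alg C₀ (π + 1 + 2 * (π + 1) / (π - σ) * π) (2 * (π + 1) / (π - σ))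
    ((1 + C₀) / v) ((β / 2 + 1) ^ 2 * C₀) (C₀ * π ^ β) hC₀ (by positivity) (by positivity)
    (by positivity) (by positivity) (by positivity)
  refine ⟨1, one_pos, C, hC, max 1 ((2 / (π - σ)) ^ (β + 2)), by positivity, ?_⟩
  intro W _ hWm _ hW0 hWV q hq E hE hEq u f hu hper hf
  have hq1 : 1 ≤ q := (le_max_left _ _).trans hq
  have hq2 : (2 / (π - σ)) ^ (β + 2) ≤ q := (le_max_right _ _).trans hq
  have hq0 : 0 < q := by linarith
  set δ := 1 / (β + 2) with hδ
  have hδ0 : 0 < δ := by positivity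
  have hδβ : (β + 2) * δ = 1 := by rw [hδ]; field_simp
  clear_value δ
  obtain ⟨κ, hκd⟩ : ∃ κ, κ = q ^ δ := ⟨_, rfl⟩
  obtain ⟨τ, hτd⟩ : ∃ τ, τ = q ^ (-δ) := ⟨_, rfl⟩
  have hκτ : κ * τ = 1 := by rw [hκd, hτd, ← rpow_add hq0]; simp
  have hκ : 1 ≤ κ := by rw [hκd]; exact one_le_rpow hq1 hδ0.le
  have hτ : 0 < τ := by rw [hτd]; positivity
  have hκ2 : 2 / (π - σ) ≤ κ := by
    rw [hκd]
    have : ((2 / (π - σ)) ^ (β + 2)) ^ δ ≤ q ^ δ := by gcongr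
    rwa [← rpow_mul (by positivity), hδβ, rpow_one] at this
  have hτL : τ ≤ (π - σ) / 2 := by
    rw [div_le_iff₀ hL] at hκ2
    nlinarith
  have hκq2 : q ^ ((2:ℝ) / (β + 2)) = κ ^ 2 := by
    rw [hκd, ← rpow_natCast, ← rpow_mul hq0.le]
    congr 1
    push_cast
    rw [div_eq_iff (by linarith)]
    linear_combination -2 * hδβ
  have hκsq : κ ^ 2 ≤ q := by
    rw [← hκq2]
    calc q ^ ((2:ℝ) / (β + 2)) ≤ q ^ (1:ℝ) := by
          apply rpow_le_rpow_of_exponent_le hq1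
          rw [div_le_one (by linarith)]; linarith
      _ = q := rpow_one q
  have hr : q * τ ^ (β + 1) = κ := by
    rw [hτd, hκd, ← rpow_mul hq0.le]
    nth_rewrite 1 [← rpow_one q]
    rw [← rpow_add hq0]
    congr 1
    linear_combination -hδβ
  obtain ⟨sb, b, b', hsb, cb, bb', db, pb, hbB, hbm⟩ :=
    exists_b σ κ τ δ q hσ0 hσπ hκ hτ hκτ hτL hκd hτd
  obtain ⟨sk, k, k', hsk, ck, bk', dk, pk, hk2, hkdsq⟩ :=
    exists_h σ β κ τ δ q hσ0 hβ hκ hτ hκτ hκd hτd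
  have hVW : ∀ x ∈ Set.Icc (-π) π, dampV σ β x ≤ C₀ * W x := by
    intro x hx
    have := (hWV x hx).1
    rw [div_le_iff₀ hC₀] at this
    linarith
  have hVpi : ∀ x ∈ Set.Icc (-π) π, dampV σ β x ≤ π ^ β := by
    intro x hx
    unfold dampV
    split_ifs with h
    · positivity
    · have : 0 < |x| - σ := by linarith
      have h2 : |x| ≤ π := abs_le.mpr hx
      gcongr
      linarith
  have hWpi : ∀ x ∈ Set.Icc (-π) π, W x ≤ C₀ * π ^ β := by
    intro x hx
    refine (hWV x hx).2.trans ?_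
    have := hVpi x hx
    gcongr
  have bW : BM W := ⟨hWm, C₀ * π ^ β, fun x hx => by
    rw [abs_of_nonneg (hW0 x)]; exact hWpi x hx⟩
  have cu1 : ContDiff ℝ 1 (deriv u) := by
    have : ContDiff ℝ (1 + 1) u := by norm_num; exact hu
    exact (contDiff_succ_iff_deriv.mp this).2.2
  have perd : Function.Periodic (deriv u) (2 * π) := by
    intro x
    have : (fun y => u (y + 2 * π)) = u := funext hper
    rw [← deriv_comp_add_const, this]
  have sol : Sol q E W u (deriv u) (deriv (deriv u)) f :=
    { hu := fun x => (hu.differentiable (by norm_num) x).hasDerivAt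
      hd := fun x => (cu1.differentiable (by norm_num) x).hasDerivAt
      cu := hu.continuous
      cd := cu1.continuous
      cdd := cu1.continuous_deriv (by norm_num)
      pu := by have := hper (-π); rw [← this]; congr 1; ring
      pd := by have := perd (-π); rw [← this]; congr 1; ring
      W0 := hW0
      bW := bW
      eq := hf }
  have hE0 : 0 ≤ E := by linarith
  have bu : BM (fun x => ‖u x‖) := .cont sol.cu.norm
  have bd : BM (fun x => ‖deriv u x‖) := .cont sol.cd.norm
  have bf := sol.bf
  have bk : BM k := .cont ck
  have bμ := mu_bm σ δ q
  have bχ := chi_bm σ δ q hq0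
  have hχ := chi_01 σ δ q hq0
  obtain ⟨N, hN⟩ : ∃ N : ℝ → ℝ, N = fun x => if (σ + π) / 2 < |x| then 1 else 0 := ⟨_, rfl⟩
  have bN : BM N := by
    refine ⟨?_, 1, fun x _ => ?_⟩
    · rw [hN]
      exact Measurable.ite (measurableSet_lt measurable_const continuous_abs.measurable)
        measurable_const measurable_const
    · rw [hN]; dsimp only; split_ifs <;> simp
  have hμ1 : ∀ x, 1 ≤ muFn σ δ q x := by
    intro x; unfold muFn; rw [← hκd]; split_ifs
    · exact hκ
    · exact le_rfl
  have hNV : ∀ x, N x ≠ 0 → N x = 1 ∧ v ≤ dampV σ β x ∧ chiFn σ δ q x = 1 := by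
    intro x hx
    rw [hN] at hx ⊢
    have hx' : (σ + π) / 2 < |x| := by
      by_contra h; exact hx (if_neg h)
    refine ⟨if_pos hx', ?_, ?_⟩
    · unfold dampV; rw [if_neg (by linarith), hv]
      gcongr; linarith
    · unfold chiFn; rw [if_neg (by linarith)]
      rw [← hτd]
      split_ifs with h
      · have : |x| - σ = τ := by linarith
        rw [this, ← hκd, hκτ]
      · rfl
  have hN1 : ∀ x, N x ≤ (1 + C₀) / v * k x ^ 2 := by
    intro x
    by_cases h : N x = 0
    · rw [h]; positivity
    · obtain ⟨h1, h2, h3⟩ := hNV x h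
      rw [h1, hk2, h3, div_mul_eq_mul_div, le_div_iff₀ hv0]
      nlinarith
  have hN2 : ∀ x ∈ Set.Icc (-π) π, N x ≤ (1 + C₀) / v * W x := by
    intro x hx
    by_cases h : N x = 0
    · rw [h]; have := hW0 x; positivity
    · obtain ⟨h1, h2, h3⟩ := hNV x h
      rw [h1, div_mul_eq_mul_div, le_div_iff₀ hv0]
      have := hVW x hx
      have := hW0 x
      nlinarith
  have hWk : ∀ x ∈ Set.Icc (-π) π, W x ≤ C₀ * (k x ^ 2 + τ ^ (β + 1) * muFn σ δ q x) := by
    intro x hx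
    refine (hWV x hx).2.trans ?_
    refine mul_le_mul_of_nonneg_left ?_ hC₀.le
    rw [hk2]
    have hrμ : 0 ≤ τ ^ (β + 1) * muFn σ δ q x := by have := hμ1 x; positivity
    have hV0 := dampV_nn σ β x
    by_cases h : |x| ≤ σ
    · have : dampV σ β x = 0 := if_pos h
      rw [this]; linarith
    · by_cases h' : |x| ≤ σ + τ
      · have e : muFn σ δ q x = κ := by
          unfold muFn; rw [← hτd, ← hκd, if_pos ⟨by linarith, h'⟩]
        have e2 : dampV σ β x ≤ τ ^ β := by
          unfold dampV; rw [if_neg h]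
          have : 0 < |x| - σ := by linarith
          gcongr; linarith
        rw [e, rpow_add_one hτ.ne', mul_assoc, mul_comm τ, hκτ, mul_one]
        have := mul_nonneg hV0 (sq_nonneg (chiFn σ δ q x))
        linarith
      · have : chiFn σ δ q x = 1 := by
          unfold chiFn; rw [← hτd, if_neg h, if_neg h']
        rw [this]; linarith
  have hkW : ∀ x ∈ Set.Icc (-π) π, k x ^ 2 ≤ C₀ * (W x * chiFn σ δ q x) := by
    intro x hx
    rw [hk2]
    obtain ⟨c0, c1⟩ := hχ x
    calc dampV σ β x * chiFn σ δ q x ^ 2 ≤ (C₀ * W x) * chiFn σ δ q x := by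
          have h1 : chiFn σ δ q x ^ 2 ≤ chiFn σ δ q x := by nlinarith
          have h2 := hVW x hx
          have := hW0 x
          have := dampV_nn σ β x
          gcongr
      _ = _ := by ring
  have hkW' : ∀ x ∈ Set.Icc (-π) π, k x ^ 2 ≤ C₀ * W x := by
    intro x hx
    refine (hkW x hx).trans ?_
    have := hW0 x
    have := (hχ x).2
    have : W x * chiFn σ δ q x ≤ W x * 1 := by gcongr
    rw [mul_one] at this
    gcongr
  have hkdW : ∀ x ∈ Set.Icc (-π) π, k' x ^ 2 ≤ (β / 2 + 1) ^ 2 * C₀ * κ ^ 2 * W x := by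
    intro x hx
    refine (hkdsq x).trans ?_
    have := mul_le_mul_of_nonneg_left (hVW x hx) (show 0 ≤ (β / 2 + 1) ^ 2 * κ ^ 2 by positivity)
    linarith
  have IQ := sol.Q
  have IH := sol.H sk hsk k k' ck bk' dk pk
  have IM := sol.M hE0 hq0.le sb hsb b b' (muFn σ δ q) N _ _ cb bb' bμ bN db pb hbB
    (fun x hx => by rw [hN]; exact hbm x hx)
  have I1 : ∫ x in (-π)..π, k x ^ 2 * (‖f x‖ * ‖u x‖) ≤
      C₀ * ∫ x in (-π)..π, W x * chiFn σ δ q x * ‖f x‖ * ‖u x‖ := by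
    rw [← intervalIntegral.integral_const_mul]
    refine mono_int (bk.sq.mul (bf.mul bu)) ((((bW.mul bχ).mul bf).mul bu).cmul _) ?_
    intro x hx
    have := mul_le_mul_of_nonneg_right (hkW x hx) (show 0 ≤ ‖f x‖ * ‖u x‖ by positivity)
    linarith
  have I2 : ∫ x in (-π)..π, k x ^ 2 * ‖u x‖ ^ 2 ≤ C₀ * ∫ x in (-π)..π, W x * ‖u x‖ ^ 2 := by
    rw [← intervalIntegral.integral_const_mul]
    refine mono_int (bk.sq.mul bu.sq) ((bW.mul bu.sq).cmul _) ?_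
    intro x hx
    have := mul_le_mul_of_nonneg_right (hkW' x hx) (show 0 ≤ ‖u x‖ ^ 2 by positivity)
    linarith
  have I3 : ∫ x in (-π)..π, k' x ^ 2 * ‖u x‖ ^ 2 ≤
      ((β / 2 + 1) ^ 2 * C₀ * κ ^ 2) * ∫ x in (-π)..π, W x * ‖u x‖ ^ 2 := by
    rw [← intervalIntegral.integral_const_mul]
    refine mono_int (bk'.sq.mul bu.sq) ((bW.mul bu.sq).cmul _) ?_
    intro x hx
    have := mul_le_mul_of_nonneg_right (hkdW x hx) (show 0 ≤ ‖u x‖ ^ 2 by positivity)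
    linarith
  have I4 : ∫ x in (-π)..π, N x * ‖deriv u x‖ ^ 2 ≤
      ((1 + C₀) / v) * ∫ x in (-π)..π, k x ^ 2 * ‖deriv u x‖ ^ 2 := by
    rw [← intervalIntegral.integral_const_mul]
    refine mono_int (bN.mul bd.sq) ((bk.sq.mul bd.sq).cmul _) ?_
    intro x hx
    have := mul_le_mul_of_nonneg_right (hN1 x) (show 0 ≤ ‖deriv u x‖ ^ 2 by positivity)
    linarith
  have I5 : ∫ x in (-π)..π, N x * ‖u x‖ ^ 2 ≤
      ((1 + C₀) / v) * ∫ x in (-π)..π, W x * ‖u x‖ ^ 2 := by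
    rw [← intervalIntegral.integral_const_mul]
    refine mono_int (bN.mul bu.sq) ((bW.mul bu.sq).cmul _) ?_
    intro x hx
    have := mul_le_mul_of_nonneg_right (hN2 x hx) (show 0 ≤ ‖u x‖ ^ 2 by positivity)
    linarith
  have I6 : ∫ x in (-π)..π, W x * ‖deriv u x‖ ^ 2 ≤
      C₀ * ((∫ x in (-π)..π, k x ^ 2 * ‖deriv u x‖ ^ 2) +
        τ ^ (β + 1) * ∫ x in (-π)..π, muFn σ δ q x * ‖deriv u x‖ ^ 2) := by
    rw [← intervalIntegral.integral_const_mul, ← intervalIntegral.integral_add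
      (bk.sq.mul bd.sq).ii ((bμ.mul bd.sq).cmul _).ii, ← intervalIntegral.integral_const_mul]
    refine mono_int (bW.mul bd.sq) (((bk.sq.mul bd.sq).add ((bμ.mul bd.sq).cmul _)).cmul _) ?_
    intro x hx
    have := mul_le_mul_of_nonneg_right (hWk x hx) (show 0 ≤ ‖deriv u x‖ ^ 2 by positivity)
    linarith
  have I7 : ∫ x in (-π)..π, 1 * ‖deriv u x‖ ^ 2 ≤ ∫ x in (-π)..π, muFn σ δ q x * ‖deriv u x‖ ^ 2 := by
    refine mono_int ((BM.const 1).mul bd.sq) (bμ.mul bd.sq) ?_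
    intro x hx
    exact mul_le_mul_of_nonneg_right (hμ1 x) (by positivity)
  have I8 : ∫ x in (-π)..π, 1 * ‖u x‖ ^ 2 ≤ ∫ x in (-π)..π, muFn σ δ q x * ‖u x‖ ^ 2 := by
    refine mono_int ((BM.const 1).mul bu.sq) (bμ.mul bu.sq) ?_
    intro x hx
    exact mul_le_mul_of_nonneg_right (hμ1 x) (by positivity)
  have I9 : ∫ x in (-π)..π, W x * chiFn σ δ q x * ‖f x‖ * ‖u x‖ ≤
      C₀ * π ^ β * ∫ x in (-π)..π, ‖f x‖ * ‖u x‖ := by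
    rw [← intervalIntegral.integral_const_mul]
    refine mono_int (((bW.mul bχ).mul bf).mul bu) ((bf.mul bu).cmul _) ?_
    intro x hx
    have h1 : W x * chiFn σ δ q x ≤ (C₀ * π ^ β) * 1 :=
      mul_le_mul (hWpi x hx) (hχ x).2 (hχ x).1 (by positivity)
    have := mul_le_mul_of_nonneg_right h1 (show 0 ≤ ‖f x‖ * ‖u x‖ by positivity)
    linarith
  have J1 := cs_int bW bu bd (fun x _ => hW0 x)
  have J2 := cs_int (BM.const 1) bf bd (fun x _ => zero_le_one)
  have J3 := cs_int (BM.const 1) bf bu (fun x _ => zero_le_one)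
  have N1 : 0 ≤ ∫ x in (-π)..π, muFn σ δ q x * ‖deriv u x‖ ^ 2 :=
    nn_int fun x _ => mul_nonneg (by linarith [hμ1 x]) (by positivity)
  have N2 : 0 ≤ ∫ x in (-π)..π, muFn σ δ q x * ‖u x‖ ^ 2 :=
    nn_int fun x _ => mul_nonneg (by linarith [hμ1 x]) (by positivity)
  have N3 := mul_nonneg hE0 N2
  have N4 : 0 ≤ ∫ x in (-π)..π, W x * ‖u x‖ ^ 2 :=
    nn_int fun x _ => mul_nonneg (hW0 x) (by positivity)
  have N5 : 0 ≤ ∫ x in (-π)..π, W x * ‖deriv u x‖ ^ 2 :=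
    nn_int fun x _ => mul_nonneg (hW0 x) (by positivity)
  simp only [one_mul] at J2 J3 I7 I8 IM
  rw [hκq2]
  refine hfin _ _ _ (∫ x in (-π)..π, W x * ‖u x‖ ^ 2) (∫ x in (-π)..π, k x ^ 2 * ‖deriv u x‖ ^ 2)
    (∫ x in (-π)..π, W x * (‖u x‖ * ‖deriv u x‖)) (∫ x in (-π)..π, ‖f x‖ * ‖deriv u x‖) _
    (∫ x in (-π)..π, ‖u x‖ ^ 2) (∫ x in (-π)..π, ‖deriv u x‖ ^ 2)
    (∫ x in (-π)..π, W x * ‖deriv u x‖ ^ 2)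
    ((∫ x in (-π)..π, N x * ‖deriv u x‖ ^ 2) + E * ∫ x in (-π)..π, N x * ‖u x‖ ^ 2)
    q E κ (τ ^ (β + 1)) (by linarith) (nn_int fun x _ => by positivity)
    (nn_int fun x _ => ?_) N4 (nn_int fun x _ => by positivity) (nn_int fun x _ => ?_)
    (nn_int fun x _ => by positivity) N5 hq1 hE hκ hEq hκsq hr IQ ?_ IM ?_ J1 ?_ J2 J3 ?_ ?_ I9
  · have := hW0 x
    have := (hχ x).1
    positivity
  · have := hW0 x
    positivity
  · have := mul_le_mul_of_nonneg_left I2 (show 0 ≤ 2 * E by positivity)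
    linarith
  · have := mul_le_mul_of_nonneg_left I5 hE0
    linarith
  · refine I6.trans (mul_le_mul_of_nonneg_left ?_ hC₀.le)
    have := mul_nonneg (rpow_nonneg hτ.le (β + 1)) N3
    linarith
  · linarith
  · have := mul_le_mul_of_nonneg_left I8 hE0
    linarith
end
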